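/- arXiv:2111.13551 — 3 statements merged into one kernel-verified Lean document; each statement's English description precedes it below -/
import Mathlib

section
/- Let Z ~ N(x, 1) and H_r the Hermite polynomial of degree r. Then E[H_r(Z)²] ≤ (e · max(x², r))^r. -/
open MeasureTheory ProbabilityTheory Polynomial

lemma hsm_derivative_hermite (n : ℕ) :
    derivative (hermite (n + 1)) = ((n : ℤ[X]) + 1) * hermite n := by
  induction n with
  | zero => simp
  | succ n ih =>
    rw [hermite_succ (n + 1), derivative_sub, derivative_mul, ih, derivative_X, derivative_mul]
    have h := hermite_succ n
    have h2 : derivative ((n : ℤ[X]) + 1) = 0 := by simp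
    rw [h2]
    push_cast
    linear_combination (-(n : ℤ[X]) - 1) * h

lemma hsm_integrable (x : ℝ) (p : ℝ[X]) :
    Integrable (fun z => p.eval z) (gaussianReal x 1) := by
  induction p using Polynomial.induction_on' with
  | add p q hp hq => simp only [eval_add]; exact hp.add hq
  | monomial n a =>
    simp only [eval_monomial]
    refine Integrable.const_mul ?_ a
    exact integrable_pow_of_mem_interior_integrableExpSet (X := fun z : ℝ => z) (by simp) n

lemma hsm_integrable_mul (x : ℝ) (p : ℝ[X]) :
    Integrable (fun z => gaussianPDFReal x 1 z * p.eval z) := by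
  have h := hsm_integrable x p
  rw [gaussianReal_of_var_ne_zero _ one_ne_zero,
    integrable_withDensity_iff_integrable_smul' (by fun_prop)
      (Filter.Eventually.of_forall fun _ => gaussianPDF_lt_top)] at h
  simpa using h

lemma hsm_stein (x : ℝ) (p : ℝ[X]) :
    ∫ z, (X * p).eval z ∂(gaussianReal x 1) =
      x * ∫ z, p.eval z ∂(gaussianReal x 1) + ∫ z, (derivative p).eval z ∂(gaussianReal x 1) := by
  have hd : ∀ z, HasDerivAt (fun z => gaussianPDFReal x 1 z * p.eval z)
      (gaussianPDFReal x 1 z * (derivative p - X * p + C x * p).eval z) z := by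
    intro z
    have h1 : HasDerivAt (gaussianPDFReal x 1) (gaussianPDFReal x 1 z * (-(z - x))) z := by
      rw [gaussianPDFReal_def]
      have h0 : HasDerivAt (fun y : ℝ => -(y - x) ^ 2 / (2 * ((1 : NNReal) : ℝ))) (-(z - x)) z := by
        have := ((((hasDerivAt_id z).sub_const x).pow 2).neg).div_const (2 * ((1 : NNReal) : ℝ))
        refine this.congr_deriv ?_
        simp
        ring
      refine ((h0.exp).const_mul _).congr_deriv ?_
      ring
    refine (h1.mul (p.hasDerivAt z)).congr_deriv ?_
    simp
    ring
  have h := integral_eq_zero_of_hasDerivAt_of_integrable hd (hsm_integrable_mul x _)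
    (hsm_integrable_mul x _)
  have h' : ∫ z, (derivative p - X * p + C x * p).eval z ∂(gaussianReal x 1) = 0 := by
    rw [integral_gaussianReal_eq_integral_smul one_ne_zero]
    simpa only [smul_eq_mul] using h
  have e : ∀ z, (derivative p - X * p + C x * p).eval z =
      (derivative p).eval z - (X * p).eval z + x * p.eval z := by intro z; simp
  simp_rw [e] at h'
  have hi : Integrable (fun z => (derivative p).eval z - (X * p).eval z) (gaussianReal x 1) :=
    (hsm_integrable x _).sub (hsm_integrable x _)
  rw [integral_add hi ((hsm_integrable x _).const_mul x), integral_sub (hsm_integrable x _) (hsm_integrable x _),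
    integral_const_mul] at h'
  linarith

/-- the real Hermite polynomial -/
noncomputable def hsmH (n : ℕ) : ℝ[X] := (hermite n).map (Int.castRingHom ℝ)

/-- the mixed moments -/
noncomputable def hsmA (x : ℝ) (m n : ℕ) : ℝ := ∫ z, (hsmH m * hsmH n).eval z ∂(gaussianReal x 1)

lemma hsm_rec (x : ℝ) (m : ℕ) (q : ℝ[X]) :
    ∫ z, (hsmH (m + 1) * q).eval z ∂(gaussianReal x 1) =
      x * ∫ z, (hsmH m * q).eval z ∂(gaussianReal x 1) +
      ∫ z, (hsmH m * derivative q).eval z ∂(gaussianReal x 1) := by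
  have hs : hsmH (m + 1) = X * hsmH m - derivative (hsmH m) := by
    simp [hsmH, hermite_succ, derivative_map]
  have h := hsm_stein x (hsmH m * q)
  have e1 : ∀ z, (hsmH (m + 1) * q).eval z =
      (X * (hsmH m * q)).eval z - (derivative (hsmH m) * q).eval z := by
    intro z; rw [hs]; simp; ring
  have e2 : ∀ z, (derivative (hsmH m * q)).eval z =
      (derivative (hsmH m) * q).eval z + (hsmH m * derivative q).eval z := by
    intro z; rw [derivative_mul, eval_add]
  simp_rw [e1]
  rw [integral_sub (hsm_integrable x _) (hsm_integrable x _), h]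
  simp_rw [e2]
  rw [integral_add (hsm_integrable x _) (hsm_integrable x _)]
  ring

lemma hsmA_comm (x : ℝ) (m n : ℕ) : hsmA x m n = hsmA x n m := by
  simp only [hsmA, mul_comm]

lemma hsmA_zero (x : ℝ) (m : ℕ) : hsmA x m 0 = x ^ m := by
  induction m with
  | zero => simp [hsmA, hsmH]
  | succ m ih =>
    rw [hsmA, hsm_rec]
    have : derivative (hsmH 0) = 0 := by simp [hsmH]
    rw [this, pow_succ', ← ih]
    simp [hsmA]

lemma hsmA_succ (x : ℝ) (m n : ℕ) :
    hsmA x (m + 1) (n + 1) = x * hsmA x m (n + 1) + (n + 1) * hsmA x m n := by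
  rw [hsmA, hsm_rec]
  have : derivative (hsmH (n + 1)) = C ((n : ℝ) + 1) * hsmH n := by
    rw [hsmH, derivative_map, hsm_derivative_hermite]
    simp [hsmH]
  rw [this, hsmA, hsmA, ← integral_const_mul ((n : ℝ) + 1)]
  congr 2
  ext z
  simp
  ring

lemma hsmA_bound (x s : ℝ) (r : ℕ) (hx : |x| ≤ s) (hr : (r : ℝ) ≤ s ^ 2) (m : ℕ) :
    ∀ n ≤ r, |hsmA x m n| ≤ 2 ^ m * s ^ (m + n) := by
  have hs : 0 ≤ s := (abs_nonneg x).trans hx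
  induction m with
  | zero =>
    intro n _
    rw [hsmA_comm, hsmA_zero, abs_pow]
    simpa using pow_le_pow_left₀ (abs_nonneg x) hx n
  | succ m ih =>
    intro n hn
    have h1 : |x * hsmA x m n| ≤ s * (2 ^ m * s ^ (m + n)) := by
      rw [abs_mul]
      exact mul_le_mul hx (ih n hn) (abs_nonneg _) hs
    cases n with
    | zero =>
      have e : hsmA x (m + 1) 0 = x * hsmA x m 0 := by rw [hsmA_zero, hsmA_zero, pow_succ']
      rw [e]
      have h3 : 0 ≤ s * (2 ^ m * s ^ (m + 0)) := by positivity
      calc _ ≤ _ := h1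
        _ ≤ s * (2 ^ m * s ^ (m + 0)) + s * (2 ^ m * s ^ (m + 0)) := by linarith
        _ = _ := by ring
    | succ n =>
      have hn2 : (n : ℝ) + 1 ≤ s ^ 2 := le_trans (by exact_mod_cast hn) hr
      have h2 : |((n : ℝ) + 1) * hsmA x m n| ≤ s ^ 2 * (2 ^ m * s ^ (m + n)) := by
        rw [abs_mul, abs_of_nonneg (by positivity : (0 : ℝ) ≤ (n : ℝ) + 1)]
        exact mul_le_mul hn2 (ih n (by omega)) (abs_nonneg _) (by positivity)
      rw [hsmA_succ]
      calc _ ≤ _ := abs_add_le _ _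
        _ ≤ _ := add_le_add h1 h2
        _ = _ := by ring

/-- For `Z ~ N(x,1)` and `H_r` the Hermite polynomial of degree `r`,
`E[H_r(Z)²] ≤ (e · max(x², r))^r`. -/
theorem hermite_sq_moment_bound (x : ℝ) (r : ℕ) :
    ∫ z, (Polynomial.aeval z (Polynomial.hermite r)) ^ 2 ∂(gaussianReal x 1)
      ≤ (Real.exp 1 * max (x ^ 2) (r : ℝ)) ^ r := by
  have e : ∫ z, (Polynomial.aeval z (Polynomial.hermite r)) ^ 2 ∂(gaussianReal x 1)
      = hsmA x r r := by
    rw [hsmA]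
    congr 1
    ext z
    simp [hsmH, sq, aeval_def, eval_map]
  have hM : 0 ≤ max (x ^ 2) (r : ℝ) := le_max_of_le_left (sq_nonneg x)
  have h := hsmA_bound x (Real.sqrt (max (x ^ 2) (r : ℝ))) r
    (Real.abs_le_sqrt (le_max_left _ _)) (by rw [Real.sq_sqrt hM]; exact le_max_right _ _) r r le_rfl
  rw [e]
  calc _ ≤ _ := le_abs_self _
    _ ≤ _ := h
    _ = (2 * max (x ^ 2) (r : ℝ)) ^ r := by
      rw [← two_mul r, pow_mul, Real.sq_sqrt hM, mul_pow]
    _ ≤ _ := by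
      have h2 : (2 : ℝ) ≤ Real.exp 1 := by linarith [Real.exp_one_gt_d9]
      gcongr
end

section
/- Let Y = A + E with E having i.i.d. standard Gaussian entries. Then E[ |(U₁)₊^{1/2} − ‖A‖_F| ] ≤ 3 (pq)^{1/4}, where U₁ = ‖Y‖_F² − pq and x₊ = max(x, 0). -/
open MeasureTheory ProbabilityTheory Matrix

/-- Frobenius norm of a real rectangular matrix. -/
noncomputable def frobNorm {p q : ℕ} (A : Matrix (Fin p) (Fin q) ℝ) : ℝ :=
  Real.sqrt (∑ i, ∑ j, A i j ^ 2)

/-- Standard Gaussian measure on `p×q` real matrices (as functions). -/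
noncomputable def gaussMatrix (p q : ℕ) : Measure (Fin p → Fin q → ℝ) :=
  Measure.pi fun _ => Measure.pi fun _ => gaussianReal 0 1

lemma aux_deriv (P P' : ℝ → ℝ) (h : ∀ t, HasDerivAt P (P' t) t) :
    deriv (fun t : ℝ => P t * Real.exp (t ^ 2 / 2))
      = fun t => (P' t + t * P t) * Real.exp (t ^ 2 / 2) := by
  funext t
  have h2 : HasDerivAt (fun t : ℝ => Real.exp (t ^ 2 / 2)) (Real.exp (t ^ 2 / 2) * t) t := by
    have h3 : HasDerivAt (fun t : ℝ => t ^ 2 / 2) t t := by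
      have := ((hasDerivAt_id t).pow 2).div_const 2
      exact this.congr_deriv (by simp)
    exact h3.exp
  refine ((h t).mul h2).deriv.trans ?_
  ring

lemma aux_moment (n : ℕ) :
    ∫ x, x ^ n ∂(gaussianReal 0 1)
      = deriv^[n] (fun t : ℝ => 1 * Real.exp (t ^ 2 / 2)) 0 := by
  have h := iteratedDeriv_mgf_zero (X := fun x : ℝ => x) (μ := gaussianReal 0 1) (by simp) n
  rw [mgf_fun_id_gaussianReal, iteratedDeriv_eq_iterate] at h
  simp only [Pi.pow_apply] at h
  rw [← h]
  simp

lemma aux_d1 : deriv (fun t : ℝ => 1 * Real.exp (t ^ 2 / 2))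
    = fun t => t * Real.exp (t ^ 2 / 2) := by
  rw [aux_deriv (fun _ => 1) (fun _ => 0) (fun t => hasDerivAt_const t 1)]
  funext t; ring

lemma aux_d2 : deriv (fun t : ℝ => t * Real.exp (t ^ 2 / 2))
    = fun t => (1 + t ^ 2) * Real.exp (t ^ 2 / 2) := by
  rw [aux_deriv (fun t => t) (fun _ => 1) (fun t => hasDerivAt_id t)]
  funext t; ring

lemma aux_d3 : deriv (fun t : ℝ => (1 + t ^ 2) * Real.exp (t ^ 2 / 2))
    = fun t => (3 * t + t ^ 3) * Real.exp (t ^ 2 / 2) := by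
  rw [aux_deriv (fun t => 1 + t ^ 2) (fun t => 2 * t)
    (fun t => by simpa using (hasDerivAt_pow 2 t).const_add 1)]
  funext t; ring

lemma aux_d4 : deriv (fun t : ℝ => (3 * t + t ^ 3) * Real.exp (t ^ 2 / 2))
    = fun t => (3 + 6 * t ^ 2 + t ^ 4) * Real.exp (t ^ 2 / 2) := by
  rw [aux_deriv (fun t => 3 * t + t ^ 3) (fun t => 3 + 3 * t ^ 2)
    (fun t => (((hasDerivAt_id t).const_mul 3).add (hasDerivAt_pow 3 t)).congr_deriv (by norm_num))]
  funext t; ring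

lemma mom1 : ∫ x, x ∂(gaussianReal 0 1) = 0 := by simp

lemma mom2 : ∫ x, x ^ 2 ∂(gaussianReal 0 1) = 1 := by
  rw [aux_moment]
  simp only [Function.iterate_succ, Function.iterate_zero, Function.comp, id, aux_d1, aux_d2]
  simp

lemma mom3 : ∫ x, x ^ 3 ∂(gaussianReal 0 1) = 0 := by
  rw [aux_moment]
  simp only [Function.iterate_succ, Function.iterate_zero, Function.comp, id, aux_d1, aux_d2,
    aux_d3]
  simp

lemma mom4 : ∫ x, x ^ 4 ∂(gaussianReal 0 1) = 3 := by
  rw [aux_moment]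
  simp only [Function.iterate_succ, Function.iterate_zero, Function.comp, id, aux_d1, aux_d2,
    aux_d3, aux_d4]
  simp

lemma int_pow (n : ℕ) : Integrable (fun x : ℝ => x ^ n) (gaussianReal 0 1) := by
  have h : MemLp id (n : ENNReal) (gaussianReal 0 1) :=
    memLp_id_gaussianReal' _ (ENNReal.natCast_ne_top n)
  refine (integrable_norm_iff (by fun_prop)).1 ?_
  simpa [norm_pow] using h.integrable_norm_pow'

noncomputable def ent (a t : ℝ) : ℝ := 2 * a * t + t ^ 2 - 1

lemma ent_sq (a : ℝ) : ∀ t, ent a t ^ 2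
    = t ^ 4 + 4 * a * t ^ 3 + (4 * a ^ 2 - 2) * t ^ 2 + (- 4 * a) * t ^ 1 + 1 * t ^ 0 := by
  intro t; unfold ent; ring

lemma ent_memLp (a : ℝ) : MemLp (ent a) 2 (gaussianReal 0 1) := by
  rw [memLp_two_iff_integrable_sq (by unfold ent; fun_prop)]
  simp_rw [ent_sq]
  exact ((((int_pow 4).add ((int_pow 3).const_mul _)).add ((int_pow 2).const_mul _)).add
    ((int_pow 1).const_mul _)).add ((int_pow 0).const_mul _)

lemma ent_mean (a : ℝ) : ∫ t, ent a t ∂(gaussianReal 0 1) = 0 := by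
  have h1 : Integrable (fun x : ℝ => x) (gaussianReal 0 1) := by simpa using int_pow 1
  unfold ent
  rw [integral_sub (by exact (h1.const_mul _).add (int_pow 2)) (integrable_const _),
    integral_add (h1.const_mul _) (int_pow 2), integral_const_mul, mom1, mom2]
  simp

lemma ent_var (a : ℝ) : Var[ent a; gaussianReal 0 1] = 4 * a ^ 2 + 2 := by
  rw [variance_of_integral_eq_zero (ent_memLp a).aemeasurable (ent_mean a)]
  have i4 := int_pow 4
  have i3 := (int_pow 3).const_mul (4 * a)
  have i2 := (int_pow 2).const_mul (4 * a ^ 2 - 2)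
  have i1 := (int_pow 1).const_mul (- 4 * a)
  have i0 := (int_pow 0).const_mul 1
  simp_rw [ent_sq]
  rw [integral_add (by exact ((i4.add i3).add i2).add i1) i0,
    integral_add (by exact (i4.add i3).add i2) i1, integral_add (by exact i4.add i3) i2, integral_add i4 i3]
  rw [integral_const_mul, integral_const_mul, integral_const_mul, integral_const_mul]
  simp only [mom4, mom3, mom2, pow_one, mom1, pow_zero]
  simp
  ring

/-- Generic step: centred sums over a product. -/
lemma pi_step {n : ℕ} {Ω : Type*} [MeasurableSpace Ω] (μ : Measure Ω) [IsProbabilityMeasure μ]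
    (X : Fin n → Ω → ℝ) (h : ∀ i, MemLp (X i) 2 μ) (h0 : ∀ i, ∫ x, X i x ∂μ = 0) :
    MemLp (fun e : Fin n → Ω => ∑ i, X i (e i)) 2 (Measure.pi fun _ => μ) ∧
    ∫ e, (∑ i, X i (e i)) ∂(Measure.pi fun _ : Fin n => μ) = 0 ∧
    Var[fun e : Fin n → Ω => ∑ i, X i (e i); Measure.pi fun _ => μ] = ∑ i, Var[X i; μ] := by
  have hm : ∀ i, MemLp (fun e : Fin n → Ω => X i (e i)) 2 (Measure.pi fun _ => μ) := fun i =>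
    (h i).comp_measurePreserving (measurePreserving_eval (fun _ => μ) i)
  refine ⟨memLp_finsetSum _ fun i _ => hm i, ?_, ?_⟩
  · rw [integral_finsetSum _ fun i _ => (hm i).integrable (by norm_num)]
    refine Finset.sum_eq_zero fun i _ => ?_
    rw [integral_comp_eval (μ := fun _ : Fin n => μ) (h i).aestronglyMeasurable, h0]
  · rw [← variance_sum_pi (μ := fun _ : Fin n => μ) h]
    congr 1
    funext e
    simp

instance (p q : ℕ) : IsProbabilityMeasure (gaussMatrix p q) := by
  unfold gaussMatrix; infer_instance

lemma frob_sq {p q : ℕ} (A : Matrix (Fin p) (Fin q) ℝ) :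
    frobNorm A ^ 2 = ∑ i, ∑ j, A i j ^ 2 :=
  Real.sq_sqrt (Finset.sum_nonneg fun _ _ => Finset.sum_nonneg fun _ _ => sq_nonneg _)

lemma U_main (p q : ℕ) (A : Matrix (Fin p) (Fin q) ℝ) :
    MemLp (fun e => frobNorm (A + Matrix.of e) ^ 2 - (p : ℝ) * q - frobNorm A ^ 2) 2
      (gaussMatrix p q) ∧
    ∫ e, (frobNorm (A + Matrix.of e) ^ 2 - (p : ℝ) * q - frobNorm A ^ 2) ^ 2 ∂(gaussMatrix p q)
      = 4 * frobNorm A ^ 2 + 2 * (p * q) := by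
  have hrow := fun i : Fin p => pi_step (gaussianReal 0 1) (fun j : Fin q => ent (A i j))
    (fun j => ent_memLp _) (fun j => ent_mean _)
  have hall := pi_step (Measure.pi fun _ : Fin q => gaussianReal 0 1)
    (fun (i : Fin p) (x : Fin q → ℝ) => ∑ j, ent (A i j) (x j))
    (fun i => (hrow i).1) (fun i => (hrow i).2.1)
  have hfun : (fun e : Fin p → Fin q → ℝ =>
      frobNorm (A + Matrix.of e) ^ 2 - (p : ℝ) * q - frobNorm A ^ 2)
      = fun e => ∑ i, ∑ j, ent (A i j) (e i j) := by
    funext e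
    have : (p : ℝ) * q = ∑ i : Fin p, ∑ j : Fin q, (1 : ℝ) := by simp
    rw [frob_sq, frob_sq, this]
    simp only [← Finset.sum_sub_distrib]
    refine Finset.sum_congr rfl fun i _ => Finset.sum_congr rfl fun j _ => ?_
    simp only [Matrix.add_apply, Matrix.of_apply, ent]
    ring
  obtain ⟨h1, h2, h3⟩ := hall
  rw [variance_of_integral_eq_zero h1.aemeasurable h2] at h3
  refine ⟨by rw [hfun]; exact h1, ?_⟩
  have hfun2 := fun e => congrFun hfun e
  simp_rw [hfun2]
  refine Eq.trans h3 ?_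
  rw [frob_sq]
  simp_rw [fun i => (hrow i).2.2, ent_var]
  simp only [Finset.sum_add_distrib, Finset.mul_sum]
  simp
  ring

lemma jensen_sq {Ω : Type*} [MeasurableSpace Ω] (μ : Measure Ω) [IsProbabilityMeasure μ]
    (f : Ω → ℝ) (h : MemLp f 2 μ) : (∫ x, f x ∂μ) ^ 2 ≤ ∫ x, f x ^ 2 ∂μ := by
  have h1 := variance_nonneg f μ
  rw [variance_eq_sub h] at h1
  simp only [Pi.pow_apply] at h1
  linarith

lemma pt1 (u a : ℝ) (ha : 0 ≤ a) : (Real.sqrt (max u 0) - a) ^ 2 ≤ |u - a ^ 2| := by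
  set s := Real.sqrt (max u 0) with hs
  have hs0 : 0 ≤ s := Real.sqrt_nonneg _
  have hs2 : s ^ 2 = max u 0 := Real.sq_sqrt (le_max_right _ _)
  rcases le_total u 0 with hu | hu
  · rw [max_eq_right hu] at hs2
    have : s = 0 := by simpa using hs2
    rw [this, abs_of_nonpos (by nlinarith)]
    nlinarith
  · rw [max_eq_left hu] at hs2
    rw [← hs2]
    rcases le_total s a with h | h
    · rw [abs_of_nonpos (by nlinarith)]; nlinarith
    · rw [abs_of_nonneg (by nlinarith)]; nlinarith

lemma pt2 (u a : ℝ) (ha : 0 ≤ a) : a * |Real.sqrt (max u 0) - a| ≤ |u - a ^ 2| := by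
  set s := Real.sqrt (max u 0) with hs
  have hs0 : 0 ≤ s := Real.sqrt_nonneg _
  have hs2 : s ^ 2 = max u 0 := Real.sq_sqrt (le_max_right _ _)
  rcases le_total u 0 with hu | hu
  · rw [max_eq_right hu] at hs2
    have : s = 0 := by simpa using hs2
    rw [this, abs_of_nonpos (a := 0 - a) (by linarith), abs_of_nonpos (a := u - a ^ 2) (by nlinarith)]
    nlinarith
  · rw [max_eq_left hu] at hs2
    rw [← hs2]
    rcases le_total s a with h | h
    · rw [abs_of_nonpos (a := s - a) (by linarith), abs_of_nonpos (a := s ^ 2 - a ^ 2) (by nlinarith)]; nlinarith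
    · rw [abs_of_nonneg (a := s - a) (by linarith), abs_of_nonneg (a := s ^ 2 - a ^ 2) (by nlinarith)]; nlinarith

/-- For `Y = A + E` with i.i.d. standard Gaussian noise and `U₁ = ‖Y‖_F² − pq`,
`E[|(U₁)₊^{1/2} − ‖A‖_F|] ≤ 3 (pq)^{1/4}`. -/
theorem sqrt_U1_risk (p q : ℕ) (A : Matrix (Fin p) (Fin q) ℝ) :
    ∫ e, |Real.sqrt (max (frobNorm (A + Matrix.of e) ^ 2 - (p : ℝ) * q) 0)
            - frobNorm A| ∂(gaussMatrix p q)
      ≤ 3 * ((p : ℝ) * q) ^ ((1 : ℝ) / 4) := by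
  obtain ⟨hD, hV⟩ := U_main p q A
  have ha : 0 ≤ frobNorm A := Real.sqrt_nonneg _
  set a := frobNorm A with hadef
  set μ := gaussMatrix p q with hμ
  set D : (Fin p → Fin q → ℝ) → ℝ :=
    fun e => frobNorm (A + Matrix.of e) ^ 2 - (p : ℝ) * q - a ^ 2 with hDdef
  set Z : (Fin p → Fin q → ℝ) → ℝ :=
    fun e => |Real.sqrt (max (frobNorm (A + Matrix.of e) ^ 2 - (p : ℝ) * q) 0) - a| with hZdef
  change ∫ e, Z e ∂μ ≤ _
  have hZm : Measurable Z := by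
    have : Measurable fun e : Fin p → Fin q → ℝ => frobNorm (A + Matrix.of e) ^ 2 := by
      simp_rw [frob_sq]
      simp only [Matrix.add_apply, Matrix.of_apply]
      fun_prop
    fun_prop
  have hZ2 : ∀ e, Z e ^ 2 ≤ |D e| := fun e => by
    simp only [hZdef, sq_abs]; exact pt1 _ _ ha
  have hZa : ∀ e, a * Z e ≤ |D e| := fun e => pt2 _ _ ha
  have hZ0 : 0 ≤ ∫ e, Z e ∂μ := integral_nonneg fun e => abs_nonneg _
  have hDi : Integrable (fun e => |D e|) μ := (hD.integrable (by norm_num)).abs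
  have hZL : MemLp Z 2 μ := by
    rw [memLp_two_iff_integrable_sq hZm.aestronglyMeasurable]
    refine hDi.mono' (by fun_prop) (Filter.Eventually.of_forall fun e => ?_)
    rw [Real.norm_of_nonneg (sq_nonneg _)]; exact hZ2 e
  have hZi : Integrable Z μ := hZL.integrable (by norm_num)
  have hd : (∫ e, |D e| ∂μ) ^ 2 ≤ 4 * a ^ 2 + 2 * (p * q) := by
    refine (jensen_sq μ _ hD.abs).trans (le_of_eq ?_)
    simp only [Pi.abs_apply, sq_abs]
    exact hV
  have hz : (∫ e, Z e ∂μ) ^ 2 ≤ ∫ e, |D e| ∂μ :=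
    (jensen_sq μ Z hZL).trans (integral_mono hZL.integrable_sq hDi hZ2)
  have hza : a * ∫ e, Z e ∂μ ≤ ∫ e, |D e| ∂μ := by
    rw [← integral_const_mul]
    exact integral_mono (hZi.const_mul _) hDi hZa
  have hN0 : (0 : ℝ) ≤ (p : ℝ) * q := by positivity
  set r : ℝ := ((p : ℝ) * q) ^ ((1 : ℝ) / 4) with hr
  have hr0 : 0 ≤ r := Real.rpow_nonneg hN0 _
  have hr4 : r ^ 4 = (p : ℝ) * q := by
    rw [hr, ← Real.rpow_natCast, ← Real.rpow_mul hN0]; norm_num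
  set z := ∫ e, Z e ∂μ
  set d := ∫ e, |D e| ∂μ
  have hd0 : 0 ≤ d := integral_nonneg fun e => abs_nonneg _
  rw [← hr4] at hd
  by_cases hc : a ^ 2 ≤ r ^ 4
  · have h4 : z ^ 4 ≤ (3 * r) ^ 4 := by
      have : z ^ 4 ≤ d ^ 2 := by
        calc z ^ 4 = (z ^ 2) ^ 2 := by ring
          _ ≤ d ^ 2 := pow_le_pow_left₀ (sq_nonneg _) hz 2
      have : 0 ≤ r ^ 4 := by positivity
      nlinarith
    exact (pow_le_pow_iff_left₀ hZ0 (by positivity) (by norm_num)).1 h4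
  · push Not at hc
    have ha0 : 0 < a := by
      rcases ha.lt_or_eq with h | h
      · exact h
      · rw [← h] at hc
        have : 0 ≤ r ^ 4 := by positivity
        norm_num at hc
        linarith
    have hr1 : 1 ≤ r := by
      have : 1 ≤ r ^ 4 := by
        rw [hr4]
        have : p * q ≠ 0 := by
          intro h0
          have : a ^ 2 = 0 := by
            rw [hadef, frob_sq]
            rcases Nat.mul_eq_zero.1 h0 with h | h <;> subst h <;> simp
          have : 0 < a ^ 2 := by positivity
          linarith
        exact_mod_cast Nat.one_le_iff_ne_zero.2 this
      by_contra hlt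
      push Not at hlt
      have := pow_lt_one₀ hr0 hlt (n := 4) (by norm_num)
      linarith
    have h1 : (a * z) ^ 2 ≤ (a * 3) ^ 2 := by
      have : (a * z) ^ 2 ≤ d ^ 2 := pow_le_pow_left₀ (by positivity) hza 2
      nlinarith
    have h2 : a * z ≤ a * 3 := (pow_le_pow_iff_left₀ (by positivity) (by positivity) (by norm_num)).1 h1
    have h3 : z ≤ 3 := le_of_mul_le_mul_left h2 ha0
    linarith
end

section
/- Let E be a p×q random matrix (p ≥ q) with i.i.d. standard Gaussian entries. Then E[ ‖EᵀE − p I_q‖_∞ ] ≤ 3√(pq) + 8 e^{−p/4} + √(64 π p). -/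
open MeasureTheory ProbabilityTheory Matrix Real

/-- Operator norm (largest singular value) of a real rectangular matrix. -/
noncomputable def opNorm {m n : ℕ} (A : Matrix (Fin m) (Fin n) ℝ) : ℝ :=
  ‖LinearMap.toContinuousLinearMap (Matrix.toEuclideanLin A)‖

namespace WishartAux

/-- standard Gaussian measure on `ι → ℝ`. -/
noncomputable def gm (ι : Type) [Fintype ι] : Measure (ι → ℝ) :=
  Measure.pi fun _ => gaussianReal 0 1

instance (ι : Type) [Fintype ι] : IsProbabilityMeasure (gm ι) := by
  unfold gm; infer_instance

lemma integrable_exp_abs (C : ℝ) : Integrable (fun x : ℝ => exp (C * |x|)) (gaussianReal 0 1) := by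
  have h1 := integrable_exp_mul_gaussianReal (μ := 0) (v := 1) C
  have h2 := integrable_exp_mul_gaussianReal (μ := 0) (v := 1) (-C)
  refine (h1.add h2).mono' (by fun_prop) (Filter.Eventually.of_forall fun x => ?_)
  rw [Real.norm_of_nonneg (exp_pos _).le]
  simp only [Pi.add_apply]
  rcases abs_cases x with ⟨h, _⟩ | ⟨h, _⟩ <;> rw [h]
  · have := exp_pos (-C * x); linarith
  · have := exp_pos (C * x)
    have e : C * -x = -C * x := by ring
    rw [e]; linarith

lemma integrable_exp_sum {ι : Type} [Fintype ι] (C : ℝ) :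
    Integrable (fun x : ι → ℝ => exp (C * ∑ i, |x i|)) (gm ι) := by
  have := Integrable.fintype_prod (ι := ι) (f := fun _ (x : ℝ) => exp (C * |x|))
    (μ := fun _ => gaussianReal 0 1) (fun _ => integrable_exp_abs C)
  refine this.congr (Filter.Eventually.of_forall fun x => ?_)
  simp only
  rw [Finset.mul_sum, Real.exp_sum]

/-- continuous with at most exponential growth -/
def Gr {ι : Type} [Fintype ι] (f : (ι → ℝ) → ℝ) : Prop :=
  Continuous f ∧ ∃ C, 0 ≤ C ∧ ∀ x, |f x| ≤ C * exp (C * ∑ i, |x i|)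

lemma Gr.integrable {ι : Type} [Fintype ι] {f : (ι → ℝ) → ℝ} (h : Gr f) : Integrable f (gm ι) := by
  obtain ⟨hc, C, hC, hb⟩ := h
  exact ((integrable_exp_sum C).const_mul C).mono' hc.aestronglyMeasurable
    (Filter.Eventually.of_forall hb)

lemma Gr.coord_mul {ι : Type} [Fintype ι] {f : (ι → ℝ) → ℝ} (h : Gr f) (i : ι) :
    Gr (fun x => x i * f x) := by
  obtain ⟨hc, C, hC, hb⟩ := h
  refine ⟨by fun_prop, C + 1, by linarith, fun x => ?_⟩
  have h0 : |x i| ≤ ∑ j, |x j| :=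
    Finset.single_le_sum (f := fun j => |x j|) (fun j _ => abs_nonneg _) (Finset.mem_univ i)
  have h1 : |x i| ≤ exp (∑ j, |x j|) := by
    have := Real.add_one_le_exp (∑ j, |x j|); linarith
  rw [abs_mul, add_mul C 1 (∑ i, |x i|), Real.exp_add, one_mul]
  calc |x i| * |f x| ≤ exp (∑ j, |x j|) * (C * exp (C * ∑ i, |x i|)) :=
        mul_le_mul h1 (hb x) (abs_nonneg _) (exp_pos _).le
    _ = C * (exp (C * ∑ i, |x i|) * exp (∑ j, |x j|)) := by ring
    _ ≤ (C + 1) * (exp (C * ∑ i, |x i|) * exp (∑ j, |x j|)) := by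
        gcongr; linarith

lemma Gr.sum {ι κ : Type} [Fintype ι] [Fintype κ] {f : κ → (ι → ℝ) → ℝ} (h : ∀ k, Gr (f k)) :
    Gr (fun x => ∑ k, f k x) := by
  choose hc C hC hb using h
  refine ⟨by fun_prop, ∑ k, C k, Finset.sum_nonneg fun k _ => hC k, fun x => ?_⟩
  refine (Finset.abs_sum_le_sum_abs _ _).trans ?_
  rw [Finset.sum_mul]
  refine Finset.sum_le_sum fun k _ => (hb k x).trans ?_
  have : C k ≤ ∑ k, C k := Finset.single_le_sum (fun k _ => hC k) (Finset.mem_univ k)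
  have h2 : 0 ≤ ∑ i, |x i| := Finset.sum_nonneg fun i _ => abs_nonneg _
  have h3 := hC k
  gcongr

lemma Gr.const_mul {ι : Type} [Fintype ι] {f : (ι → ℝ) → ℝ} (h : Gr f) (c : ℝ) :
    Gr (fun x => c * f x) := by
  obtain ⟨hc, C, hC, hb⟩ := h
  refine ⟨by fun_prop, C + |c| * C, by positivity, fun x => ?_⟩
  have h2 : 0 ≤ ∑ i, |x i| := Finset.sum_nonneg fun i _ => abs_nonneg _
  have h4 : 0 ≤ |c| * C := by positivity
  rw [abs_mul]
  calc |c| * |f x| ≤ |c| * (C * exp (C * ∑ i, |x i|)) := by gcongr; exact hb x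
    _ = (|c| * C) * exp (C * ∑ i, |x i|) := by ring
    _ ≤ _ := by gcongr <;> linarith

/-- one-dimensional Stein identity -/
lemma stein1 {f f' : ℝ → ℝ} (hd : ∀ t, HasDerivAt f (f' t) t)
    (h0 : Integrable f (gaussianReal 0 1)) (h1 : Integrable (fun t => t * f t) (gaussianReal 0 1))
    (h2 : Integrable f' (gaussianReal 0 1)) :
    ∫ t, t * f t ∂(gaussianReal 0 1) = ∫ t, f' t ∂(gaussianReal 0 1) := by
  have conv : ∀ g : ℝ → ℝ, Integrable g (gaussianReal 0 1) →
      Integrable (fun t => gaussianPDFReal 0 1 t * g t) := by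
    intro g hg
    rw [gaussianReal_of_var_ne_zero 0 one_ne_zero] at hg
    rw [integrable_withDensity_iff_integrable_smul₀' (by fun_prop)
      (Filter.Eventually.of_forall fun x => by simp [gaussianPDF])] at hg
    simpa [gaussianPDF, ENNReal.toReal_ofReal, gaussianPDFReal_nonneg] using hg
  have hp : ∀ t, HasDerivAt (gaussianPDFReal 0 1) (-(t * gaussianPDFReal 0 1 t)) t := by
    intro t
    unfold gaussianPDFReal
    have h : HasDerivAt (fun x : ℝ => -(x - 0) ^ 2 / (2 * ((1 : NNReal) : ℝ))) (-t) t := by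
      have := (((hasDerivAt_id t).sub_const 0).pow 2).neg.div_const (2 * ((1 : NNReal) : ℝ))
      convert! this using 1
      simp; ring
    convert! (h.exp.const_mul ((√(2 * π * ((1 : NNReal) : ℝ)))⁻¹)) using 1
    ring
  have key := integral_mul_deriv_eq_deriv_mul_of_integrable (u := gaussianPDFReal 0 1) (v := f)
    (u' := fun t => -(t * gaussianPDFReal 0 1 t)) (v' := f') (fun t _ => hp t) (fun t _ => hd t) (conv _ h2)
    (by
      have := (conv _ h1).neg
      refine this.congr (Filter.Eventually.of_forall fun t => ?_)
      simp; ring)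
    (conv _ h0)
  rw [integral_gaussianReal_eq_integral_smul one_ne_zero,
    integral_gaussianReal_eq_integral_smul one_ne_zero]
  simp only [smul_eq_mul]
  rw [key, ← integral_neg]
  congr 1; ext t; ring

lemma mp_update {ι : Type} [Fintype ι] [DecidableEq ι] (i : ι) :
    MeasurePreserving (fun z : (ι → ℝ) × ℝ => Function.update z.1 i z.2)
      ((gm ι).prod (gaussianReal 0 1)) (gm ι) := by
  have hm : Measurable (fun z : (ι → ℝ) × ℝ => Function.update z.1 i z.2) := by
    refine measurable_pi_lambda _ fun j => ?_
    by_cases h : j = i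
    · subst h; simpa using measurable_snd
    · simp [Function.update_of_ne h]; fun_prop
  refine ⟨hm, ?_⟩
  unfold gm
  symm
  refine Measure.pi_eq fun s hs => ?_
  rw [Measure.map_apply hm (MeasurableSet.univ_pi hs)]
  have : (fun z : (ι → ℝ) × ℝ => Function.update z.1 i z.2) ⁻¹' (Set.univ.pi s)
      = (Set.univ.pi (Function.update s i Set.univ)) ×ˢ (s i) := by
    ext z
    simp only [Set.mem_preimage, Set.mem_univ_pi, Set.mem_prod]
    constructor
    · intro h
      refine ⟨fun j => ?_, by simpa using h i⟩
      by_cases hj : j = i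
      · subst hj; simp
      · simpa [Function.update_of_ne hj] using h j
    · rintro ⟨h, h'⟩ j
      by_cases hj : j = i
      · subst hj; simpa using h'
      · simpa [Function.update_of_ne hj] using h j
  rw [this, Measure.prod_prod, Measure.pi_pi, ← Finset.mul_prod_erase _ _ (Finset.mem_univ i),
    ← Finset.mul_prod_erase Finset.univ (fun j => (gaussianReal 0 1) (s j)) (Finset.mem_univ i)]
  simp only [Function.update_self, measure_univ, one_mul]
  rw [mul_comm]
  congr 1
  refine Finset.prod_congr rfl fun j hj => ?_
  rw [Function.update_of_ne (Finset.ne_of_mem_erase hj)]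

lemma stein {ι : Type} [Fintype ι] [DecidableEq ι] (i : ι) {f f' : (ι → ℝ) → ℝ} (hf : Gr f) (hf' : Gr f')
    (hd : ∀ x, HasDerivAt (fun t => f (Function.update x i t)) (f' x) (x i)) :
    ∫ x, x i * f x ∂(gm ι) = ∫ x, f' x ∂(gm ι) := by
  have mp := mp_update i
  have tr : ∀ g : (ι → ℝ) → ℝ, Gr g →
      Integrable (fun z : (ι → ℝ) × ℝ => g (Function.update z.1 i z.2))
        ((gm ι).prod (gaussianReal 0 1)) ∧
      ∫ x, g x ∂(gm ι) = ∫ x, ∫ t, g (Function.update x i t) ∂(gaussianReal 0 1) ∂(gm ι) := by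
    intro g hg
    have hi : Integrable (fun z : (ι → ℝ) × ℝ => g (Function.update z.1 i z.2))
        ((gm ι).prod (gaussianReal 0 1)) := mp.integrable_comp_of_integrable hg.integrable
    refine ⟨hi, ?_⟩
    rw [← integral_prod _ hi]
    rw [← mp.map_eq, integral_map mp.measurable.aemeasurable]
    rw [mp.map_eq]; exact hg.1.aestronglyMeasurable
  have hxf := hf.coord_mul i
  rw [(tr _ hxf).2, (tr _ hf').2]
  refine integral_congr_ae ?_
  filter_upwards [(tr _ hxf).1.prod_right_ae, (tr _ hf').1.prod_right_ae,
    (tr _ hf).1.prod_right_ae] with x h1 h2 h3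
  simp only [Function.update_self] at h1 ⊢
  refine stein1 (f := fun t => f (Function.update x i t)) (fun t => ?_) h3 h1 h2
  have := hd (Function.update x i t)
  simpa using this



/-- `F1 a` are the partial derivatives of `F` (chain rule along paths). -/
def PD {J : Type} [Fintype J] (F : (J → ℝ) → ℝ) (F1 : J → (J → ℝ) → ℝ) : Prop :=
  ∀ (c : ℝ → J → ℝ) (c' : J → ℝ) (t : ℝ), (∀ a, HasDerivAt (fun s => c s a) (c' a) t) →
    HasDerivAt (fun s => F (c s)) (∑ a, F1 a (c t) * c' a) t

/-- interpolating linear map -/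
noncomputable def Zm {J ι₁ ι₂ : Type} [Fintype ι₁] [Fintype ι₂]
    (A : J → ι₁ → ℝ) (B : J → ι₂ → ℝ) (u w : ℝ) (x : ι₁ ⊕ ι₂ → ℝ) (a : J) : ℝ :=
  u * ∑ i, A a i * x (Sum.inl i) + w * ∑ i, B a i * x (Sum.inr i)

set_option linter.unusedSectionVars false

section
variable {J ι₁ ι₂ : Type} [Fintype J] [Fintype ι₁] [Fintype ι₂]
  (A : J → ι₁ → ℝ) (B : J → ι₂ → ℝ)

lemma Zm_cont (u w : ℝ) : Continuous (Zm A B u w) := by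
  unfold Zm; fun_prop

/-- bound constant -/
noncomputable def KK : ℝ := ∑ a, ((∑ i, |A a i|) + ∑ i, |B a i|)

lemma KK_nonneg : 0 ≤ KK A B := by unfold KK; positivity

lemma Zm_bound_one (u w : ℝ) (hu : |u| ≤ 1) (hw : |w| ≤ 1) (x : ι₁ ⊕ ι₂ → ℝ) (a : J) :
    |Zm A B u w x a| ≤ ((∑ i, |A a i|) + ∑ i, |B a i|) * ∑ i, |x i| := by
  have hx : ∀ i, |x i| ≤ ∑ i, |x i| := fun i =>
    Finset.single_le_sum (f := fun j => |x j|) (fun j _ => abs_nonneg _) (Finset.mem_univ i)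
  have h1 : |∑ i, A a i * x (Sum.inl i)| ≤ (∑ i, |A a i|) * ∑ i, |x i| := by
    refine (Finset.abs_sum_le_sum_abs _ _).trans ?_
    rw [Finset.sum_mul]
    refine Finset.sum_le_sum fun i _ => ?_
    rw [abs_mul]; gcongr; exact hx _
  have h2 : |∑ i, B a i * x (Sum.inr i)| ≤ (∑ i, |B a i|) * ∑ i, |x i| := by
    refine (Finset.abs_sum_le_sum_abs _ _).trans ?_
    rw [Finset.sum_mul]
    refine Finset.sum_le_sum fun i _ => ?_
    rw [abs_mul]; gcongr; exact hx _
  unfold Zm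
  refine (abs_add_le _ _).trans ?_
  rw [abs_mul, abs_mul, add_mul]
  have := abs_nonneg (∑ i, A a i * x (Sum.inl i))
  have := abs_nonneg (∑ i, B a i * x (Sum.inr i))
  nlinarith

lemma Zm_bound (u w : ℝ) (hu : |u| ≤ 1) (hw : |w| ≤ 1) (x : ι₁ ⊕ ι₂ → ℝ) :
    ∑ a, |Zm A B u w x a| ≤ KK A B * ∑ i, |x i| := by
  unfold KK
  rw [Finset.sum_mul]
  exact Finset.sum_le_sum fun a _ => Zm_bound_one A B u w hu hw x a

lemma Gr.comp_Zm {f : (J → ℝ) → ℝ} (h : Gr f) (u w : ℝ) (hu : |u| ≤ 1) (hw : |w| ≤ 1) :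
    Gr (fun x => f (Zm A B u w x)) := by
  obtain ⟨hc, C, hC, hb⟩ := h
  have hK := KK_nonneg A B
  refine ⟨hc.comp (Zm_cont A B u w), C + C * KK A B, by positivity, fun x => ?_⟩
  have h2 : 0 ≤ ∑ i, |x i| := Finset.sum_nonneg fun i _ => abs_nonneg _
  refine (hb _).trans ?_
  have h3 : C * ∑ a, |Zm A B u w x a| ≤ (C + C * KK A B) * ∑ i, |x i| := by
    have := mul_le_mul_of_nonneg_left (Zm_bound A B u w hu hw x) hC
    nlinarith [mul_nonneg hC h2]
  have h4 : 0 ≤ C * KK A B := by positivity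
  gcongr
  linarith

lemma Zm_hasDerivAt (θ : ℝ) (x : ι₁ ⊕ ι₂ → ℝ) (a : J) :
    HasDerivAt (fun s => Zm A B (cos s) (sin s) x a) (Zm A B (-sin θ) (cos θ) x a) θ := by
  unfold Zm
  exact ((hasDerivAt_cos θ).mul_const _).add ((hasDerivAt_sin θ).mul_const _)

lemma Zm_eq (u w : ℝ) (x : ι₁ ⊕ ι₂ → ℝ) (a : J) :
    Zm A B u w x a = ∑ i, Sum.elim (fun i => u * A a i) (fun i => w * B a i) i * x i := by
  unfold Zm
  simp [Finset.mul_sum, mul_assoc]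

variable {F : (J → ℝ) → ℝ} {F1 : J → (J → ℝ) → ℝ} {F2 : J → J → (J → ℝ) → ℝ}

lemma interp_hasDerivAt (hF : Gr F) (hF1 : ∀ a, Gr (F1 a)) (hd : PD F F1) (θ : ℝ) :
    HasDerivAt (fun θ => ∫ x, F (Zm A B (cos θ) (sin θ) x) ∂(gm (ι₁ ⊕ ι₂)))
      (∫ x, ∑ a, F1 a (Zm A B (cos θ) (sin θ) x) * Zm A B (-sin θ) (cos θ) x a
        ∂(gm (ι₁ ⊕ ι₂))) θ := by
  have hK := KK_nonneg A B
  have hG : ∀ a, ∃ C, 0 ≤ C ∧ ∀ x, |F1 a x| ≤ C * exp (C * ∑ i, |x i|) := fun a => (hF1 a).2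
  choose C hC hb using hG
  have hcont : ∀ θ, Continuous (fun x => F (Zm A B (cos θ) (sin θ) x)) := fun θ =>
    hF.1.comp (Zm_cont A B _ _)
  have hc1 : ∀ a, Continuous (F1 a) := fun a => (hF1 a).1
  have hz := fun u w => Zm_cont A B u w
  refine (hasDerivAt_integral_of_dominated_loc_of_deriv_le (𝕜 := ℝ)
    (bound := fun x => ∑ a, (C a * KK A B) * exp ((C a * KK A B + 1) * ∑ i, |x i|))
    (F' := fun θ x => ∑ a, F1 a (Zm A B (cos θ) (sin θ) x) * Zm A B (-sin θ) (cos θ) x a)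
    Filter.univ_mem ?_ ?_ ?_ ?_ ?_ ?_).2
  · exact Filter.Eventually.of_forall fun θ => (hcont θ).aestronglyMeasurable
  · exact (hF.comp_Zm A B _ _ (abs_cos_le_one _) (abs_sin_le_one _)).integrable
  · refine Continuous.aestronglyMeasurable ?_
    refine continuous_finsetSum _ fun a _ => ?_
    exact ((hc1 a).comp (hz _ _)).mul ((continuous_apply a).comp (hz _ _))
  · refine Filter.Eventually.of_forall fun x s _ => ?_
    rw [Real.norm_eq_abs]
    refine (Finset.abs_sum_le_sum_abs _ _).trans (Finset.sum_le_sum fun a _ => ?_)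
    rw [abs_mul]
    have h2 : 0 ≤ ∑ i, |x i| := Finset.sum_nonneg fun i _ => abs_nonneg _
    have b1 := Zm_bound A B (cos s) (sin s) (abs_cos_le_one _) (abs_sin_le_one _) x
    have b2 : |Zm A B (-sin s) (cos s) x a| ≤ KK A B * ∑ i, |x i| :=
      (Finset.single_le_sum (f := fun a => |Zm A B (-sin s) (cos s) x a|)
        (fun _ _ => abs_nonneg _) (Finset.mem_univ a)).trans
      (Zm_bound A B (-sin s) (cos s) (by rw [abs_neg]; exact abs_sin_le_one _)
        (abs_cos_le_one _) x)
    have b3 : ∑ i, |x i| ≤ exp (∑ i, |x i|) := by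
      have := Real.add_one_le_exp (∑ j, |x j|); linarith
    have hCa := hC a
    calc _ ≤ (C a * exp (C a * (KK A B * ∑ i, |x i|))) * (KK A B * exp (∑ i, |x i|)) := by
          refine mul_le_mul ((hb a _).trans ?_) (b2.trans ?_) (abs_nonneg _) (by positivity)
          · gcongr
          · gcongr
      _ = _ := by
          rw [add_mul, one_mul, Real.exp_add, mul_assoc (C a) (KK A B) (∑ i, |x i|)]
          ring
  · refine integrable_finsetSum _ fun a _ => (integrable_exp_sum _).const_mul _
  · refine Filter.Eventually.of_forall fun x s _ => ?_
    exact hd (fun s => Zm A B (cos s) (sin s) x) (Zm A B (-sin s) (cos s) x) s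
      (fun a => Zm_hasDerivAt A B s x a)

open Classical in
lemma interp_ibp (hF1 : ∀ a, Gr (F1 a)) (hF2 : ∀ a b, Gr (F2 a b))
    (hd : ∀ a, PD (F1 a) (F2 a)) (θ : ℝ) :
    (∫ x, ∑ a, F1 a (Zm A B (cos θ) (sin θ) x) * Zm A B (-sin θ) (cos θ) x a
        ∂(gm (ι₁ ⊕ ι₂))) =
    ∫ x, sin θ * cos θ * ∑ a, ∑ b, ((∑ i, B a i * B b i) - ∑ i, A a i * A b i) *
      F2 a b (Zm A B (cos θ) (sin θ) x) ∂(gm (ι₁ ⊕ ι₂)) := by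
  have hcs := abs_cos_le_one θ
  have hsn := abs_sin_le_one θ
  set M : J → ι₁ ⊕ ι₂ → ℝ := fun a => Sum.elim (fun i => cos θ * A a i) (fun i => sin θ * B a i)
    with hM
  set M' : J → ι₁ ⊕ ι₂ → ℝ := fun a => Sum.elim (fun i => -sin θ * A a i) (fun i => cos θ * B a i)
    with hM'
  set Z := fun x => Zm A B (cos θ) (sin θ) x with hZ
  have g1 : ∀ a, Gr (fun x => F1 a (Z x)) := fun a => (hF1 a).comp_Zm A B _ _ hcs hsn
  have g2 : ∀ a b, Gr (fun x => F2 a b (Z x)) := fun a b => (hF2 a b).comp_Zm A B _ _ hcs hsn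
  have st : ∀ a i, ∫ x, x i * F1 a (Z x) ∂(gm (ι₁ ⊕ ι₂)) =
      ∫ x, ∑ b, M b i * F2 a b (Z x) ∂(gm (ι₁ ⊕ ι₂)) := by
    intro a i
    refine stein i (g1 a) (Gr.sum fun b => (g2 a b).const_mul _) fun x => ?_
    set f2sum := ∑ b, M b i * F2 a b (Z x) with hf2
    have := hd a (fun t => Z (Function.update x i t)) (fun b => M b i) (x i) (fun b => ?_)
    · have e : f2sum = ∑ b, F2 a b (Z (Function.update x i (x i))) * M b i := by
        rw [hf2, show Function.update x i (x i) = x from Function.update_eq_self i x]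
        exact Finset.sum_congr rfl fun b _ => mul_comm _ _
      rw [e]; exact this
    · simp only [hZ, Zm_eq]
      have h := HasDerivAt.fun_sum (u := Finset.univ) (x := x i)
        (A := fun j t => M b j * Function.update x i t j) (A' := fun j => M b j * (Pi.single i (1 : ℝ) : ι₁ ⊕ ι₂ → ℝ) j)
        (fun j _ => ((hasDerivAt_pi.1 (hasDerivAt_update x i (x i))) j).const_mul _)
      convert! h using 1
      simp [Pi.single_apply]
  have e1 : ∀ x, ∑ a, F1 a (Z x) * Zm A B (-sin θ) (cos θ) x a
      = ∑ a, ∑ i, M' a i * (x i * F1 a (Z x)) := by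
    intro x
    refine Finset.sum_congr rfl fun a _ => ?_
    rw [Zm_eq, Finset.mul_sum]
    refine Finset.sum_congr rfl fun i _ => ?_
    simp only [hM']; ring
  have i1 : ∀ a i, Integrable (fun x => M' a i * (x i * F1 a (Z x))) (gm (ι₁ ⊕ ι₂)) :=
    fun a i => (((g1 a).coord_mul i).const_mul _).integrable
  have e2 : ∀ x, sin θ * cos θ * ∑ a, ∑ b, ((∑ i, B a i * B b i) - ∑ i, A a i * A b i) *
      F2 a b (Z x) = ∑ a, ∑ i, M' a i * ∑ b, M b i * F2 a b (Z x) := by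
    intro x
    rw [Finset.mul_sum]
    refine Finset.sum_congr rfl fun a _ => ?_
    simp_rw [Finset.mul_sum]
    rw [Finset.sum_comm]
    refine Finset.sum_congr rfl fun b _ => ?_
    simp only [hM, hM', Fintype.sum_sum_type, Sum.elim_inl, Sum.elim_inr]
    have r1 : ∑ i, -sin θ * A a i * (cos θ * A b i * F2 a b (Z x)) =
        (-(sin θ * cos θ) * F2 a b (Z x)) * ∑ i, A a i * A b i := by
      rw [Finset.mul_sum]; exact Finset.sum_congr rfl fun i _ => by ring
    have r2 : ∑ i, cos θ * B a i * (sin θ * B b i * F2 a b (Z x)) =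
        ((sin θ * cos θ) * F2 a b (Z x)) * ∑ i, B a i * B b i := by
      rw [Finset.mul_sum]; exact Finset.sum_congr rfl fun i _ => by ring
    rw [r1, r2]; ring
  have i2 : ∀ a i, Integrable (fun x => M' a i * ∑ b, M b i * F2 a b (Z x)) (gm (ι₁ ⊕ ι₂)) :=
    fun a i => ((Gr.sum fun b => (g2 a b).const_mul (M b i)).const_mul _).integrable
  change ∫ x, ∑ a, F1 a (Z x) * Zm A B (-sin θ) (cos θ) x a ∂(gm (ι₁ ⊕ ι₂)) =
    ∫ x, sin θ * cos θ * ∑ a, ∑ b, ((∑ i, B a i * B b i) - ∑ i, A a i * A b i) *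
      F2 a b (Z x) ∂(gm (ι₁ ⊕ ι₂))
  simp_rw [e1, e2]
  rw [integral_finsetSum _ (fun a _ => integrable_finsetSum _ fun i _ => i1 a i),
    integral_finsetSum _ (fun a _ => integrable_finsetSum _ fun i _ => i2 a i)]
  refine Finset.sum_congr rfl fun a _ => ?_
  rw [integral_finsetSum _ (fun i _ => i1 a i), integral_finsetSum _ (fun i _ => i2 a i)]
  refine Finset.sum_congr rfl fun i _ => ?_
  rw [integral_const_mul, integral_const_mul, st]

/-- Kahane Gaussian comparison inequality. -/
lemma kahane (hF : Gr F) (hF1 : ∀ a, Gr (F1 a)) (hF2 : ∀ a b, Gr (F2 a b))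
    (hd : PD F F1) (hd2 : ∀ a, PD (F1 a) (F2 a))
    (hpos : ∀ z, 0 ≤ ∑ a, ∑ b, ((∑ i, B a i * B b i) - ∑ i, A a i * A b i) * F2 a b z) :
    ∫ x, F (fun a => ∑ i, A a i * x i) ∂(gm ι₁) ≤ ∫ y, F (fun a => ∑ i, B a i * y i) ∂(gm ι₂) := by
  set φ : ℝ → ℝ := fun θ => ∫ x, F (Zm A B (cos θ) (sin θ) x) ∂(gm (ι₁ ⊕ ι₂)) with hφ
  have hder := fun θ => interp_hasDerivAt A B hF hF1 hd θ
  have mono : MonotoneOn φ (Set.Icc 0 (π / 2)) := by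
    refine monotoneOn_of_deriv_nonneg (convex_Icc _ _)
      (fun θ _ => (hder θ).continuousAt.continuousWithinAt)
      (fun θ _ => (hder θ).differentiableAt.differentiableWithinAt) fun θ hθ => ?_
    rw [interior_Icc] at hθ
    rw [(hder θ).deriv, interp_ibp A B hF1 hF2 hd2 θ]
    refine integral_nonneg fun x => ?_
    have h1 : 0 ≤ sin θ := sin_nonneg_of_nonneg_of_le_pi hθ.1.le (by linarith [hθ.2, pi_pos])
    have h2 : 0 ≤ cos θ := cos_nonneg_of_mem_Icc ⟨by linarith [hθ.1, pi_pos], hθ.2.le⟩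
    exact mul_nonneg (mul_nonneg h1 h2) (hpos _)
  have h := mono (Set.left_mem_Icc.2 (by positivity)) (Set.right_mem_Icc.2 (by positivity))
    (by positivity : (0 : ℝ) ≤ π / 2)
  have mp := measurePreserving_sumPiEquivProdPi (ι := ι₁) (ι' := ι₂) (X := fun _ => ℝ)
    (fun _ => gaussianReal 0 1)
  have m1 : MeasurePreserving (fun x : ι₁ ⊕ ι₂ → ℝ => fun i => x (Sum.inl i))
      (gm (ι₁ ⊕ ι₂)) (gm ι₁) := measurePreserving_fst.comp mp
  have m2 : MeasurePreserving (fun x : ι₁ ⊕ ι₂ → ℝ => fun i => x (Sum.inr i))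
      (gm (ι₁ ⊕ ι₂)) (gm ι₂) := measurePreserving_snd.comp mp
  have c1 : Continuous (fun x : ι₁ → ℝ => F (fun a => ∑ i, A a i * x i)) :=
    hF.1.comp (by fun_prop)
  have c2 : Continuous (fun x : ι₂ → ℝ => F (fun a => ∑ i, B a i * x i)) :=
    hF.1.comp (by fun_prop)
  rw [← m1.map_eq, ← m2.map_eq, integral_map m1.measurable.aemeasurable c1.aestronglyMeasurable,
    integral_map m2.measurable.aemeasurable c2.aestronglyMeasurable]
  have z1 : ∀ x : ι₁ ⊕ ι₂ → ℝ, Zm A B 1 0 x = fun a => ∑ i, A a i * x (Sum.inl i) := by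
    intro x; ext a; simp [Zm]
  have z2 : ∀ x : ι₁ ⊕ ι₂ → ℝ, Zm A B 0 1 x = fun a => ∑ i, B a i * x (Sum.inr i) := by
    intro x; ext a; simp [Zm]
  simpa [hφ, z1, z2] using h

end



set_option linter.unusedSectionVars false

section
variable {J : Type} [Fintype J]

lemma PD.congr {f : (J → ℝ) → ℝ} {f1 g1 : J → (J → ℝ) → ℝ} (h : PD f f1)
    (e : ∀ a z, f1 a z = g1 a z) : PD f g1 := by
  have : f1 = g1 := by ext a z; exact e a z
  exact this ▸ h

lemma PD.comp {f : (J → ℝ) → ℝ} {f1 : J → (J → ℝ) → ℝ} (h : PD f f1) {φ : ℝ → ℝ}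
    {φ' : (J → ℝ) → ℝ} (hφ : ∀ z, HasDerivAt φ (φ' z) (f z)) :
    PD (fun z => φ (f z)) (fun a z => φ' z * f1 a z) := by
  intro c c' t hc
  have := (hφ (c t)).comp t (h c c' t hc)
  rw [Finset.mul_sum] at this
  simpa only [mul_assoc, Function.comp_def] using this

lemma PD.mul {f g : (J → ℝ) → ℝ} {f1 g1 : J → (J → ℝ) → ℝ} (hf : PD f f1) (hg : PD g g1) :
    PD (fun z => f z * g z) (fun a z => f1 a z * g z + f z * g1 a z) := by
  intro c c' t hc
  have := (hf c c' t hc).mul (hg c c' t hc)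
  convert! this using 1
  rw [Finset.sum_mul, Finset.mul_sum, ← Finset.sum_add_distrib]
  exact Finset.sum_congr rfl fun a _ => by ring

lemma PD.add {f g : (J → ℝ) → ℝ} {f1 g1 : J → (J → ℝ) → ℝ} (hf : PD f f1) (hg : PD g g1) :
    PD (fun z => f z + g z) (fun a z => f1 a z + g1 a z) := by
  intro c c' t hc
  have := (hf c c' t hc).add (hg c c' t hc)
  convert! this using 1
  rw [← Finset.sum_add_distrib]
  exact Finset.sum_congr rfl fun a _ => by ring

lemma PD.const_mul {f : (J → ℝ) → ℝ} {f1 : J → (J → ℝ) → ℝ} (hf : PD f f1) (k : ℝ) :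
    PD (fun z => k * f z) (fun a z => k * f1 a z) := by
  intro c c' t hc
  have := (hf c c' t hc).const_mul k
  convert! this using 1
  rw [Finset.mul_sum]
  exact Finset.sum_congr rfl fun a _ => by ring

lemma PD.const (k : ℝ) : PD (fun _ : J → ℝ => k) (fun _ _ => 0) := by
  intro c c' t hc
  simpa using hasDerivAt_const t k

lemma PD.sum {κ : Type} [Fintype κ] {f : κ → (J → ℝ) → ℝ} {f1 : κ → J → (J → ℝ) → ℝ}
    (hf : ∀ k, PD (f k) (f1 k)) :
    PD (fun z => ∑ k, f k z) (fun a z => ∑ k, f1 k a z) := by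
  intro c c' t hc
  have := HasDerivAt.fun_sum (u := Finset.univ) (fun k _ => hf k c c' t hc)
  convert! this using 1
  rw [Finset.sum_comm]
  exact Finset.sum_congr rfl fun a _ => by rw [Finset.sum_mul]

lemma PD.coord [DecidableEq J] (a : J) :
    PD (fun z : J → ℝ => z a) (fun b _ => if b = a then 1 else 0) := by
  intro c c' t hc
  simpa using hc a

end

section
variable {V : Type} [Fintype V] [DecidableEq V] {p : ℕ} (k r ε : ℝ)

/-- smoothed norm -/
noncomputable def nn (v : V) (z : V × Option (Fin p) → ℝ) : ℝ := √(ε + ∑ i, z (v, some i) ^ 2)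

/-- exponent -/
noncomputable def ell (v : V) (z : V × Option (Fin p) → ℝ) : ℝ := nn ε v z + z (v, none)

/-- log partition function -/
noncomputable def LL (z : V × Option (Fin p) → ℝ) : ℝ := log (∑ v, exp (k * ell ε v z))

/-- the smooth function -/
noncomputable def FF (z : V × Option (Fin p) → ℝ) : ℝ := exp (r * LL k ε z)

/-- Gibbs weights -/
noncomputable def PP (v : V) (z : V × Option (Fin p) → ℝ) : ℝ := exp (k * ell ε v z - LL k ε z)

/-- derivative of the exponent -/
noncomputable def rho (v : V) (o : Option (Fin p)) (z : V × Option (Fin p) → ℝ) : ℝ :=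
  match o with
  | none => 1
  | some i => z (v, some i) * (nn ε v z)⁻¹

/-- second derivative of the exponent -/
noncomputable def drho (v : V) (o o' : Option (Fin p)) (z : V × Option (Fin p) → ℝ) : ℝ :=
  match o, o' with
  | some i, some j => (if j = i then 1 else 0) * (nn ε v z)⁻¹
      - (z (v, some i) * (nn ε v z)⁻¹) * (z (v, some j) * (nn ε v z)⁻¹) * (nn ε v z)⁻¹
  | _, _ => 0

/-- first derivatives -/
noncomputable def FF1 (a : V × Option (Fin p)) (z : V × Option (Fin p) → ℝ) : ℝ :=
  r * k * (FF k r ε z * (PP k ε a.1 z * rho ε a.1 a.2 z))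

/-- second derivatives -/
noncomputable def FF2 (a b : V × Option (Fin p)) (z : V × Option (Fin p) → ℝ) : ℝ :=
  r * k * (FF1 k r ε b z * (PP k ε a.1 z * rho ε a.1 a.2 z) + FF k r ε z *
    ((PP k ε a.1 z * (k * (if b.1 = a.1 then rho ε a.1 b.2 z else 0)
      - k * (PP k ε b.1 z * rho ε b.1 b.2 z))) * rho ε a.1 a.2 z
     + PP k ε a.1 z * (if b.1 = a.1 then drho ε a.1 a.2 b.2 z else 0)))

variable {k r ε}

lemma nn_pos (hε : 0 < ε) (v : V) (z : V × Option (Fin p) → ℝ) : 0 < nn ε v z := by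
  unfold nn; positivity

lemma nn_sq (hε : 0 < ε) (v : V) (z : V × Option (Fin p) → ℝ) :
    nn ε v z ^ 2 = ε + ∑ i, z (v, some i) ^ 2 := by
  unfold nn; rw [Real.sq_sqrt (by positivity)]

lemma nn_PD (hε : 0 < ε) (v : V) : PD (nn (p := p) ε v)
    (fun b z => if b.1 = v then (match b.2 with
      | none => 0
      | some i => z (v, some i) * (nn ε v z)⁻¹) else 0) := by
  have h := ((PD.const (J := V × Option (Fin p)) ε).add
    (PD.sum (fun i : Fin p => (PD.coord (v, some i)).mul (PD.coord (v, some i))))).comp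
    (φ := Real.sqrt) (φ' := fun z => 1 / (2 * nn ε v z)) (fun z => by
      have := Real.hasDerivAt_sqrt (x := ε + ∑ i, z (v, some i) * z (v, some i))
        (by have : 0 ≤ ∑ i, z (v, some i) * z (v, some i) :=
              Finset.sum_nonneg fun i _ => mul_self_nonneg _
            positivity)
      simpa only [nn, pow_two] using this)
  have e : nn (p := p) ε v = (fun z => √(ε + ∑ i, z (v, some i) * z (v, some i))) := by
    ext z; simp only [nn, pow_two]
  rw [e]
  refine h.congr fun b z => ?_
  rw [← e]
  obtain ⟨w, o⟩ := b
  have hp := nn_pos hε v z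
  by_cases hw : w = v
  · subst hw
    cases o with
    | none => simp
    | some i =>
      simp [Finset.sum_add_distrib]
      field_simp
      ring
  · simp [hw]

lemma ell_PD (hε : 0 < ε) (v : V) : PD (ell (p := p) ε v)
    (fun b z => if b.1 = v then rho ε v b.2 z else 0) := by
  refine ((nn_PD hε v).add (PD.coord (v, none))).congr fun b z => ?_
  obtain ⟨w, o⟩ := b
  by_cases hw : w = v
  · subst hw; cases o <;> simp [rho]
  · simp [hw]

lemma rho_PD (hε : 0 < ε) (v : V) (o : Option (Fin p)) : PD (rho (p := p) ε v o)
    (fun b z => if b.1 = v then drho ε v o b.2 z else 0) := by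
  cases o with
  | none => exact (PD.const 1).congr fun b z => by simp [drho]
  | some i =>
    have h := (PD.coord (J := V × Option (Fin p)) (v, some i)).mul ((nn_PD (p := p) hε v).comp
      (φ := fun x => x⁻¹) (fun z => hasDerivAt_inv (nn_pos hε v z).ne'))
    refine h.congr fun b z => ?_
    obtain ⟨w, o⟩ := b
    have hp := nn_pos hε v z
    by_cases hw : w = v
    · subst hw
      cases o with
      | none => simp [drho]
      | some j =>
        simp [drho]
        split_ifs <;> field_simp <;> ring
    · simp [hw]

variable [Nonempty V]

lemma T_pos (z : V × Option (Fin p) → ℝ) : 0 < ∑ v, exp (k * ell ε v z) :=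
  Finset.sum_pos (fun _ _ => exp_pos _) Finset.univ_nonempty

lemma PP_eq (v : V) (z : V × Option (Fin p) → ℝ) :
    PP k ε v z = (∑ v, exp (k * ell ε v z))⁻¹ * exp (k * ell ε v z) := by
  unfold PP LL
  rw [Real.exp_sub, Real.exp_log (T_pos z)]; field_simp

lemma LL_PD (hε : 0 < ε) : PD (LL (V := V) (p := p) k ε)
    (fun b z => k * (PP k ε b.1 z * rho ε b.1 b.2 z)) := by
  have h := (PD.sum (fun v : V => ((ell_PD (p := p) hε v).const_mul k).comp (φ := Real.exp)
    (fun z => Real.hasDerivAt_exp _))).comp (φ := Real.log)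
    (fun z => Real.hasDerivAt_log (T_pos z).ne')
  refine h.congr fun b z => ?_
  rw [PP_eq]
  simp
  ring

lemma FF_PD (hε : 0 < ε) : PD (FF (V := V) (p := p) k r ε) (FF1 k r ε) := by
  have h := ((LL_PD (V := V) (p := p) (k := k) hε).const_mul r).comp (φ := Real.exp)
    (fun z => Real.hasDerivAt_exp _)
  refine h.congr fun b z => ?_
  unfold FF1 FF
  ring

lemma PP_PD (hε : 0 < ε) (v : V) : PD (PP (p := p) k ε v)
    (fun b z => PP k ε v z * (k * (if b.1 = v then rho ε v b.2 z else 0)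
      - k * (PP k ε b.1 z * rho ε b.1 b.2 z))) := by
  have h := (((ell_PD (p := p) hε v).const_mul k).add
    ((LL_PD (V := V) (p := p) (k := k) hε).const_mul (-1))).comp (φ := Real.exp)
    (fun z => Real.hasDerivAt_exp _)
  have e : PP (p := p) k ε v = fun z => exp (k * ell ε v z + -1 * LL k ε z) := by
    ext z; unfold PP; congr 1; ring
  rw [← e] at h
  refine h.congr fun b z => ?_
  rw [← show PP (p := p) k ε v z = exp (k * ell ε v z + -1 * LL k ε z) from by rw [e]]
  ring

lemma FF1_PD (hε : 0 < ε) (a : V × Option (Fin p)) : PD (FF1 k r ε a) (FF2 k r ε a) := by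
  have h := ((FF_PD (V := V) (p := p) (k := k) (r := r) hε).mul
    ((PP_PD (p := p) (k := k) hε a.1).mul (rho_PD hε a.1 a.2))).const_mul (r * k)
  refine h.congr fun b z => ?_
  unfold FF2
  ring



lemma nn_cont (v : V) : Continuous (nn (p := p) ε v) := by unfold nn; fun_prop

lemma rho_cont (hε : 0 < ε) (v : V) (o : Option (Fin p)) : Continuous (rho ε v o) := by
  have h := (nn_cont (p := p) (ε := ε) v).inv₀ (fun z => (nn_pos hε v z).ne')
  cases o with
  | none => exact continuous_const
  | some i => exact (continuous_apply _).mul h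

lemma drho_cont (hε : 0 < ε) (v : V) (o o' : Option (Fin p)) : Continuous (drho ε v o o') := by
  have h := (nn_cont (p := p) (ε := ε) v).inv₀ (fun z => (nn_pos hε v z).ne')
  cases o with
  | none => exact continuous_const
  | some i =>
    cases o' with
    | none => exact continuous_const
    | some j =>
      unfold drho
      exact (continuous_const.mul h).sub ((((continuous_apply _).mul h).mul
        ((continuous_apply _).mul h)).mul h)

lemma ell_cont (v : V) : Continuous (ell (p := p) ε v) :=
  (nn_cont v).add (continuous_apply _)

lemma LL_cont : Continuous (LL (V := V) (p := p) k ε) := by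
  unfold LL
  have := fun v : V => ell_cont (p := p) (ε := ε) v
  exact Continuous.log (by fun_prop) (fun z => (T_pos z).ne')

lemma PP_cont (v : V) : Continuous (PP (p := p) k ε v) := by
  unfold PP
  have := ell_cont (p := p) (ε := ε) v
  have := LL_cont (V := V) (p := p) (k := k) (ε := ε)
  fun_prop

lemma FF_cont : Continuous (FF (V := V) (p := p) k r ε) := by
  unfold FF
  have := LL_cont (V := V) (p := p) (k := k) (ε := ε)
  fun_prop

lemma FF1_cont (hε : 0 < ε) (a : V × Option (Fin p)) : Continuous (FF1 k r ε a) := by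
  unfold FF1
  exact continuous_const.mul (FF_cont.mul ((PP_cont _).mul (rho_cont hε _ _)))

lemma FF2_cont (hε : 0 < ε) (a b : V × Option (Fin p)) : Continuous (FF2 k r ε a b) := by
  have h1 := FF_cont (V := V) (p := p) (k := k) (r := r) (ε := ε)
  have h2 := fun v : V => PP_cont (p := p) (k := k) (ε := ε) v
  have h3 := fun (v : V) o => rho_cont (p := p) hε v o
  have h4 := FF1_cont (k := k) (r := r) hε b
  have h5 := fun (v : V) o o' => drho_cont (p := p) hε v o o'
  unfold FF2
  split_ifs <;> fun_prop

end



set_option linter.unusedSectionVars false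

section
variable {V : Type} [Fintype V] [DecidableEq V] [Nonempty V] {p q : ℕ} {k r ε : ℝ}

lemma abs_coord_le_nn (hε : 0 < ε) (v : V) (i : Fin p) (z : V × Option (Fin p) → ℝ) :
    |z (v, some i)| ≤ nn ε v z := by
  unfold nn
  rw [← Real.sqrt_sq_eq_abs]
  apply Real.sqrt_le_sqrt
  have := Finset.single_le_sum (f := fun i => z (v, some i) ^ 2) (fun i _ => sq_nonneg _)
    (Finset.mem_univ i)
  linarith

lemma sqrt_le_nn (v : V) (z : V × Option (Fin p) → ℝ) : √ε ≤ nn ε v z := by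
  unfold nn
  apply Real.sqrt_le_sqrt
  have : 0 ≤ ∑ i, z (v, some i) ^ 2 := by positivity
  linarith

lemma nn_le (hε : 0 < ε) (v : V) (z : V × Option (Fin p) → ℝ) :
    nn ε v z ≤ √ε + ∑ i, |z (v, some i)| := by
  unfold nn
  apply Real.sqrt_le_iff.2
  have h0 : 0 ≤ ∑ i, |z (v, some i)| := by positivity
  refine ⟨by positivity, ?_⟩
  have h1 : ∑ i, z (v, some i) ^ 2 ≤ (∑ i, |z (v, some i)|) ^ 2 := by
    have := Finset.sum_sq_le_sq_sum_of_nonneg (s := Finset.univ) (f := fun i => |z (v, some i)|) (fun i _ => abs_nonneg _)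
    simpa using this
  have h2 := Real.sq_sqrt hε.le
  nlinarith [Real.sqrt_nonneg ε, mul_nonneg (Real.sqrt_nonneg ε) h0]

lemma abs_ell_le (hε : 0 < ε) (v : V) (z : V × Option (Fin p) → ℝ) :
    |ell ε v z| ≤ √ε + ∑ a, |z a| := by
  have h1 : |ell ε v z| ≤ √ε + ∑ o, |z (v, o)| := by
    rw [Fintype.sum_option]
    unfold ell
    refine (abs_add_le _ _).trans ?_
    rw [abs_of_pos (nn_pos hε v z)]
    linarith [nn_le hε v z]
  have h2 : ∑ o, |z (v, o)| ≤ ∑ a, |z a| := by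
    rw [Fintype.sum_prod_type]
    exact Finset.single_le_sum (f := fun v => ∑ o, |z (v, o)|)
      (fun v _ => by positivity) (Finset.mem_univ v)
  linarith

lemma FF_bound (hε : 0 < ε) (hr : 0 ≤ r) (z : V × Option (Fin p) → ℝ) :
    FF k r ε z ≤ exp (r * log (Fintype.card V) + r * |k| * √ε) * exp (r * |k| * ∑ a, |z a|) := by
  unfold FF LL
  rw [← Real.exp_add]
  apply Real.exp_le_exp.2
  have h1 : ∑ v, exp (k * ell ε v z) ≤ Fintype.card V * exp (|k| * (√ε + ∑ a, |z a|)) := by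
    rw [← nsmul_eq_mul]
    refine Finset.sum_le_card_nsmul _ _ _ fun v _ => ?_
    apply Real.exp_le_exp.2
    calc k * ell ε v z ≤ |k * ell ε v z| := le_abs_self _
      _ = |k| * |ell ε v z| := abs_mul _ _
      _ ≤ _ := by gcongr; exact abs_ell_le hε v z
  have h2 := Real.log_le_log (T_pos z) h1
  have hN : (0 : ℝ) < Fintype.card V := by exact_mod_cast Fintype.card_pos
  rw [Real.log_mul hN.ne' (exp_pos _).ne', Real.log_exp] at h2
  nlinarith

lemma FF_pos (z : V × Option (Fin p) → ℝ) : 0 < FF k r ε z := exp_pos _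

lemma Gr_of_le (hε : 0 < ε) (hr : 0 ≤ r) {g : (V × Option (Fin p) → ℝ) → ℝ} (hg : Continuous g)
    (c : ℝ) (hc : 0 ≤ c) (h : ∀ z, |g z| ≤ c * FF k r ε z) : Gr g := by
  refine ⟨hg, c * exp (r * log (Fintype.card V) + r * |k| * √ε) + r * |k|, by positivity,
    fun z => (h z).trans ?_⟩
  have h0 : 0 ≤ ∑ a, |z a| := by positivity
  have h1 : 0 ≤ c * exp (r * log (Fintype.card V) + r * |k| * √ε) := by positivity
  have h2 : 0 ≤ r * |k| := by positivity
  calc c * FF k r ε z ≤ c * (exp (r * log (Fintype.card V) + r * |k| * √ε) *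
        exp (r * |k| * ∑ a, |z a|)) := by gcongr; exact FF_bound hε hr z
    _ = (c * exp (r * log (Fintype.card V) + r * |k| * √ε)) * exp (r * |k| * ∑ a, |z a|) := by ring
    _ ≤ _ := by gcongr <;> linarith

lemma PP_pos (v : V) (z : V × Option (Fin p) → ℝ) : 0 < PP k ε v z := exp_pos _

lemma PP_le (v : V) (z : V × Option (Fin p) → ℝ) : PP k ε v z ≤ 1 := by
  rw [PP_eq, inv_mul_le_iff₀ (T_pos z), mul_one]
  exact Finset.single_le_sum (f := fun v => exp (k * ell ε v z)) (fun v _ => (exp_pos _).le)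
    (Finset.mem_univ v)

lemma abs_PP_le (v : V) (z : V × Option (Fin p) → ℝ) : |PP k ε v z| ≤ 1 := by
  rw [abs_of_pos (PP_pos v z)]; exact PP_le v z

lemma abs_rho_le (hε : 0 < ε) (v : V) (o : Option (Fin p)) (z : V × Option (Fin p) → ℝ) :
    |rho ε v o z| ≤ 1 := by
  cases o with
  | none => simp [rho]
  | some i =>
    have h := nn_pos hε v z
    simp only [rho]
    rw [abs_mul, abs_inv, abs_of_pos h, mul_inv_le_iff₀ h, one_mul]
    exact abs_coord_le_nn hε v i z

lemma abs_drho_le (hε : 0 < ε) (v : V) (o o' : Option (Fin p)) (z : V × Option (Fin p) → ℝ) :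
    |drho ε v o o' z| ≤ 2 * (√ε)⁻¹ := by
  have hs : 0 < √ε := Real.sqrt_pos.2 hε
  cases o with
  | none => simp [drho]
  | some i =>
    cases o' with
    | none => simp [drho]
    | some j =>
      have h := nn_pos hε v z
      have h1 := abs_rho_le hε v (some i) z
      have h2 := abs_rho_le hε v (some j) z
      have h3 : (nn ε v z)⁻¹ ≤ (√ε)⁻¹ := by
        apply inv_anti₀ hs (sqrt_le_nn v z)
      have h4 : 0 < (nn ε v z)⁻¹ := by positivity
      simp only [rho] at h1 h2
      simp only [drho]
      refine (abs_sub _ _).trans ?_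
      have h5 : |(if j = i then (1 : ℝ) else 0) * (nn ε v z)⁻¹| ≤ (√ε)⁻¹ := by
        split_ifs
        · rw [one_mul, abs_of_pos h4]; exact h3
        · simp
      rw [abs_mul (_ * _) ((nn ε v z)⁻¹), abs_of_pos h4, abs_mul (_ * _) (_ * _)]
      have h6 := mul_le_one₀ h1 (abs_nonneg _) h2
      have h7 := mul_le_mul h6 h3 h4.le zero_le_one
      linarith

lemma FF1_bound (hε : 0 < ε) (a : V × Option (Fin p)) (z : V × Option (Fin p) → ℝ) :
    |FF1 k r ε a z| ≤ |r * k| * FF k r ε z := by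
  unfold FF1
  rw [abs_mul (r * k), abs_mul (FF k r ε z), abs_mul (PP k ε a.1 z), abs_of_pos (FF_pos z)]
  have := mul_le_one₀ (abs_PP_le (k := k) (ε := ε) a.1 z) (abs_nonneg _) (abs_rho_le hε a.1 a.2 z)
  have h2 := FF_pos (k := k) (r := r) (ε := ε) z
  gcongr
  nlinarith

lemma FF2_bound (hε : 0 < ε) (a b : V × Option (Fin p)) (z : V × Option (Fin p) → ℝ) :
    |FF2 k r ε a b z| ≤ (|r * k| * (|r * k| + (2 * |k| + 2 * (√ε)⁻¹))) * FF k r ε z := by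
  have hF := FF_pos (k := k) (r := r) (ε := ε) z
  have b1 := FF1_bound (k := k) (r := r) hε b z
  have P := fun v : V => abs_PP_le (k := k) (ε := ε) v z
  have R := fun (v : V) o => abs_rho_le hε v o z
  have PR := fun (v w : V) o => mul_le_one₀ (P v) (abs_nonneg _) (R w o)
  have t1 : |FF1 k r ε b z * (PP k ε a.1 z * rho ε a.1 a.2 z)| ≤ |r * k| * FF k r ε z := by
    rw [abs_mul, abs_mul (PP _ _ _ _)]
    calc _ ≤ |r * k| * FF k r ε z * 1 := by
          refine mul_le_mul b1 (PR _ _ _) (by positivity) (by positivity)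
      _ = _ := mul_one _
  have t2 : |k * (if b.1 = a.1 then rho ε a.1 b.2 z else 0)
      - k * (PP k ε b.1 z * rho ε b.1 b.2 z)| ≤ 2 * |k| := by
    refine (abs_sub _ _).trans ?_
    rw [abs_mul, abs_mul, abs_mul (PP _ _ _ _)]
    have h1 : |if b.1 = a.1 then rho ε a.1 b.2 z else 0| ≤ 1 := by
      split_ifs
      · exact R _ _
      · simp
    have h2 := PR b.1 b.1 b.2
    nlinarith [abs_nonneg k]
  have t3 : |if b.1 = a.1 then drho ε a.1 a.2 b.2 z else 0| ≤ 2 * (√ε)⁻¹ := by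
    split_ifs
    · exact abs_drho_le hε _ _ _ z
    · simp
  unfold FF2
  rw [abs_mul (r * k), mul_assoc |r * k|]
  refine mul_le_mul_of_nonneg_left ?_ (abs_nonneg (r * k))
  refine (abs_add_le _ _).trans ?_
  rw [add_mul]
  refine add_le_add t1 ?_
  rw [abs_mul, abs_of_pos hF, mul_comm]
  refine mul_le_mul_of_nonneg_right ?_ hF.le
  refine (abs_add_le _ _).trans (add_le_add ?_ ?_)
  · rw [abs_mul, abs_mul]
    calc _ ≤ 1 * (2 * |k|) * 1 :=
          mul_le_mul (mul_le_mul (P _) t2 (abs_nonneg _) zero_le_one) (R _ _) (abs_nonneg _)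
            (by positivity)
      _ = _ := by ring
  · rw [abs_mul]
    calc _ ≤ 1 * (2 * (√ε)⁻¹) := mul_le_mul (P _) t3 (abs_nonneg _) zero_le_one
      _ = _ := by ring

lemma FF_Gr (hε : 0 < ε) (hr : 0 ≤ r) : Gr (FF (V := V) (p := p) k r ε) :=
  Gr_of_le hε hr FF_cont 1 zero_le_one fun z => by rw [one_mul, abs_of_pos (FF_pos z)]

lemma FF1_Gr (hε : 0 < ε) (hr : 0 ≤ r) (a : V × Option (Fin p)) : Gr (FF1 k r ε a) :=
  Gr_of_le hε hr (FF1_cont hε a) _ (abs_nonneg _) fun z => FF1_bound hε a z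

lemma FF2_Gr (hε : 0 < ε) (hr : 0 ≤ r) (a b : V × Option (Fin p)) : Gr (FF2 k r ε a b) :=
  Gr_of_le hε hr (FF2_cont hε a b) _ (by positivity) fun z => FF2_bound hε a b z

/-- coefficients of the original process -/
def AA (x : V → Fin q → ℝ) (a : V × Option (Fin p)) (s : (Fin p × Fin q) ⊕ Unit) : ℝ :=
  match a.2, s with
  | some i, Sum.inl t => if t.1 = i then x a.1 t.2 else 0
  | none, Sum.inr _ => 1
  | _, _ => 0

/-- coefficients of the comparison process -/
def BB (x : V → Fin q → ℝ) (a : V × Option (Fin p)) (s : Fin p ⊕ Fin q) : ℝ :=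
  match a.2, s with
  | some i, Sum.inl t => if t = i then 1 else 0
  | none, Sum.inr j => x a.1 j
  | _, _ => 0

/-- sign pattern -/
def sgn (o o' : Option (Fin p)) : ℝ :=
  match o, o' with
  | some i, some j => if i = j then 1 else 0
  | none, none => -1
  | _, _ => 0

lemma cov_diff (x : V → Fin q → ℝ) (a b : V × Option (Fin p)) :
    (∑ i, BB x a i * BB x b i) - ∑ i, AA x a i * AA x b i =
      (1 - ∑ j, x a.1 j * x b.1 j) * sgn a.2 b.2 := by
  obtain ⟨v, o⟩ := a
  obtain ⟨w, o'⟩ := b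
  cases o with
  | none =>
    cases o' with
    | none => simp [AA, BB, sgn]
    | some j => simp [AA, BB, sgn]
  | some i =>
    cases o' with
    | none => simp [AA, BB, sgn]
    | some j =>
      by_cases h : i = j
      · subst h
        simp [AA, BB, sgn, Fintype.sum_prod_type]
      · simp [AA, BB, sgn, Fintype.sum_prod_type, h, Ne.symm h]

lemma rho_inner_le (hε : 0 < ε) (v w : V) (z : V × Option (Fin p) → ℝ) :
    ∑ i, rho ε v (some i) z * rho ε w (some i) z ≤ 1 := by
  have h : ∀ v : V, ∑ i, rho ε v (some i) z ^ 2 ≤ 1 := by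
    intro v
    simp only [rho, mul_pow]
    rw [← Finset.sum_mul, inv_pow, mul_inv_le_iff₀ (pow_pos (nn_pos hε v z) 2), nn_sq hε]
    linarith
  have h1 : ∑ i, rho ε v (some i) z * rho ε w (some i) z
      ≤ ∑ i, (rho ε v (some i) z ^ 2 + rho ε w (some i) z ^ 2) / 2 :=
    Finset.sum_le_sum fun i _ => by
      nlinarith [sq_nonneg (rho ε v (some i) z - rho ε w (some i) z)]
  rw [← Finset.sum_div, Finset.sum_add_distrib] at h1
  linarith [h v, h w]

lemma FF2_off (a b : V × Option (Fin p)) (h : a.1 ≠ b.1) (z : V × Option (Fin p) → ℝ) :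
    FF2 k r ε a b z = (r * (r - 1) * k ^ 2 * FF k r ε z * PP k ε a.1 z * PP k ε b.1 z) *
      (rho ε a.1 a.2 z * rho ε b.1 b.2 z) := by
  unfold FF2 FF1
  simp [Ne.symm h]
  ring

lemma inner_le_one (x : V → Fin q → ℝ) (hx : ∀ v, ∑ j, x v j ^ 2 = 1) (v w : V) :
    ∑ j, x v j * x w j ≤ 1 := by
  have h1 : ∑ j, x v j * x w j ≤ ∑ j, (x v j ^ 2 + x w j ^ 2) / 2 :=
    Finset.sum_le_sum fun i _ => by nlinarith [sq_nonneg (x v i - x w i)]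
  rw [← Finset.sum_div, Finset.sum_add_distrib, hx, hx] at h1
  linarith

lemma hpos (hε : 0 < ε) (hr : 0 ≤ r) (hr1 : r ≤ 1) (x : V → Fin q → ℝ)
    (hx : ∀ v, ∑ j, x v j ^ 2 = 1) (z : V × Option (Fin p) → ℝ) :
    0 ≤ ∑ a, ∑ b, ((∑ i, BB x a i * BB x b i) - ∑ i, AA x a i * AA x b i) * FF2 k r ε a b z := by
  simp_rw [cov_diff]
  have e : ∀ f : V × Option (Fin p) → V × Option (Fin p) → ℝ, ∑ a, ∑ b, f a b =
      ∑ v, ∑ w, ∑ o, ∑ o', f (v, o) (w, o') := by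
    intro f
    simp_rw [Fintype.sum_prod_type]
    refine Finset.sum_congr rfl fun v _ => ?_
    rw [Finset.sum_comm]
  rw [e]
  refine Finset.sum_nonneg fun v _ => Finset.sum_nonneg fun w _ => ?_
  by_cases h : v = w
  · subst h
    have : ∑ j, x v j * x v j = 1 := by rw [← hx v]; simp [pow_two]
    simp [this]
  · simp only [FF2_off (V := V) (v, _) (w, _) h]
    simp only [Fintype.sum_option, sgn]
    simp
    have h1 := inner_le_one x hx v w
    have h2 := rho_inner_le hε v w z
    have h3 : 0 ≤ r * (1 - r) * k ^ 2 * FF k r ε z * PP k ε v z * PP k ε w z := by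
      have := FF_pos (k := k) (r := r) (ε := ε) z
      have := PP_pos (k := k) (ε := ε) v z
      have := PP_pos (k := k) (ε := ε) w z
      have : 0 ≤ 1 - r := by linarith
      positivity
    have e1 : ∑ i, (1 - ∑ j, x v j * x w j) * (r * (r - 1) * k ^ 2 * FF k r ε z * PP k ε v z *
        PP k ε w z * (rho ε v (some i) z * rho ε w (some i) z)) =
        (1 - ∑ j, x v j * x w j) * (r * (r - 1) * k ^ 2 * FF k r ε z * PP k ε v z *
        PP k ε w z) * ∑ i, rho ε v (some i) z * rho ε w (some i) z := by
      rw [Finset.mul_sum]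
      exact Finset.sum_congr rfl fun i _ => by ring
    rw [e1]
    simp only [rho] at h2 ⊢
    have h4 := mul_nonneg (mul_nonneg (sub_nonneg.2 h1) h3) (sub_nonneg.2 h2)
    linarith

lemma comparison (hε : 0 < ε) (hr : 0 ≤ r) (hr1 : r ≤ 1) (x : V → Fin q → ℝ)
    (hx : ∀ v, ∑ j, x v j ^ 2 = 1) :
    ∫ y, FF k r ε (fun a : V × Option (Fin p) => ∑ i, AA x a i * y i)
        ∂(gm ((Fin p × Fin q) ⊕ Unit)) ≤
      ∫ y, FF k r ε (fun a : V × Option (Fin p) => ∑ i, BB x a i * y i) ∂(gm (Fin p ⊕ Fin q)) :=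
  kahane (AA x) (BB x) (FF_Gr hε hr) (FF1_Gr hε hr) (FF2_Gr hε hr) (FF_PD hε) (FF1_PD hε)
    (hpos hε hr hr1 x hx)

end



lemma integral_exp_sq {c : ℝ} (hc : c < 1 / 2) :
    ∫ t, exp (c * t ^ 2) ∂(gaussianReal 0 1) = (√(1 - 2 * c))⁻¹ := by
  rw [integral_gaussianReal_eq_integral_smul one_ne_zero]
  have e : ∀ t : ℝ, gaussianPDFReal 0 1 t • exp (c * t ^ 2)
      = (√(2 * π))⁻¹ * exp (-(1 / 2 - c) * t ^ 2) := by
    intro t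
    simp only [gaussianPDFReal, smul_eq_mul, NNReal.coe_one, mul_one, sub_zero]
    rw [mul_assoc, ← Real.exp_add]
    congr 2; ring
  simp_rw [e]
  rw [integral_const_mul, integral_gaussian]
  have h1 : (0 : ℝ) < 1 - 2 * c := by linarith
  have h2 : π / (1 / 2 - c) = (2 * π) * (1 - 2 * c)⁻¹ := by
    have : 1 / 2 - c ≠ 0 := by linarith
    field_simp
  rw [h2, Real.sqrt_mul (by positivity : (0 : ℝ) ≤ 2 * π) ((1 - 2 * c)⁻¹), Real.sqrt_inv]
  have : √(2 * π) ≠ 0 := by positivity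
  field_simp

lemma integral_exp_sum_sq {n : ℕ} {c : ℝ} (hc : c < 1 / 2) :
    ∫ x, exp (c * ∑ i, x i ^ 2) ∂(gm (Fin n)) = ((√(1 - 2 * c))⁻¹) ^ n := by
  have e : ∀ x : Fin n → ℝ, exp (c * ∑ i, x i ^ 2) = ∏ i, exp (c * x i ^ 2) := by
    intro x; rw [Finset.mul_sum, Real.exp_sum]
  simp_rw [e]
  unfold gm
  rw [integral_fintype_prod_eq_prod (𝕜 := ℝ) (fun (_ : Fin n) (t : ℝ) => exp (c * t ^ 2))]
  simp [integral_exp_sq hc]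

lemma integrable_exp_sum_sq {n : ℕ} {c : ℝ} (hc : c < 1 / 2) :
    Integrable (fun x : Fin n → ℝ => exp (c * ∑ i, x i ^ 2)) (gm (Fin n)) := by
  by_contra h
  have h1 := integral_undef h
  rw [integral_exp_sum_sq hc] at h1
  have h2 : (0 : ℝ) < 1 - 2 * c := by linarith
  have : 0 < ((√(1 - 2 * c))⁻¹) ^ n := by positivity
  linarith

lemma inv_sqrt_pow_le {c β : ℝ} (n : ℕ) (hc : c < 1 / 2) (h : 1 ≤ exp (2 * β) * (1 - 2 * c)) :
    ((√(1 - 2 * c))⁻¹) ^ n ≤ exp (n * β) := by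
  rw [Real.exp_nat_mul]
  have h2 : (0 : ℝ) < 1 - 2 * c := by linarith
  gcongr
  rw [inv_le_iff_one_le_mul₀ (by positivity)]
  have h3 : exp β = √(exp (2 * β)) := by
    rw [two_mul, Real.exp_add, Real.sqrt_mul_self (exp_pos _).le]
  rw [h3, ← Real.sqrt_mul (exp_pos _).le]
  exact Real.one_le_sqrt.2 h

lemma h_bound {n : ℕ} (hn : 1 ≤ n) :
    ∫ x, exp (√(∑ i, x i ^ 2)) ∂(gm (Fin n)) ≤ exp (√n + 1 / 2) := by
  set s : ℝ := √n with hs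
  have hs1 : 1 ≤ s := by rw [hs]; exact Real.one_le_sqrt.2 (by exact_mod_cast hn)
  have hsn : s * s = n := Real.mul_self_sqrt (by positivity)
  have hc : 1 / (2 * (s + 1)) < (1 : ℝ) / 2 := by
    apply one_div_lt_one_div_of_lt <;> linarith
  have h1 : ∫ x, exp (√(∑ i, x i ^ 2)) ∂(gm (Fin n)) ≤
      ∫ x : Fin n → ℝ, exp ((s + 1) / 2) * exp (1 / (2 * (s + 1)) * ∑ i, x i ^ 2) ∂(gm (Fin n)) := by
    refine integral_mono_of_nonneg (Filter.Eventually.of_forall fun x => (exp_pos _).le)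
      ((integrable_exp_sum_sq hc).const_mul _) (Filter.Eventually.of_forall fun x => ?_)
    simp only
    rw [← Real.exp_add]
    apply Real.exp_le_exp.2
    have hS : 0 ≤ ∑ i, x i ^ 2 := by positivity
    set t := √(∑ i, x i ^ 2)
    have ht : t ^ 2 = ∑ i, x i ^ 2 := Real.sq_sqrt hS
    rw [← ht]
    have : (s + 1) / 2 + 1 / (2 * (s + 1)) * t ^ 2 - t = (t - (s + 1)) ^ 2 / (2 * (s + 1)) := by
      field_simp; ring
    have : 0 ≤ (t - (s + 1)) ^ 2 / (2 * (s + 1)) := by positivity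
    linarith
  rw [integral_const_mul, integral_exp_sum_sq hc] at h1
  have h2 : 1 ≤ exp (2 * (1 / (2 * s))) * (1 - 2 * (1 / (2 * (s + 1)))) := by
    have a1 : 1 / s + 1 ≤ exp (2 * (1 / (2 * s))) := by
      have := Real.add_one_le_exp (1 / s)
      convert this using 2
      field_simp
    have a2 : 1 - 2 * (1 / (2 * (s + 1))) = s / (s + 1) := by field_simp; ring
    rw [a2]
    calc (1 : ℝ) = (1 / s + 1) * (s / (s + 1)) := by field_simp; ring
      _ ≤ _ := by gcongr
  have h3 := inv_sqrt_pow_le n hc h2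
  refine h1.trans ((mul_le_mul_of_nonneg_left h3 (exp_pos _).le).trans ?_)
  rw [← Real.exp_add, ← hsn]
  apply Real.exp_le_exp.2
  apply le_of_eq
  field_simp; ring

lemma g_bound {n : ℕ} (hn : 1 ≤ n) :
    ∫ x, exp (-√(∑ i, x i ^ 2)) ∂(gm (Fin n)) ≤ 2 * exp (1 - √n) := by
  set s : ℝ := √n with hs
  have hs1 : 1 ≤ s := by rw [hs]; exact Real.one_le_sqrt.2 (by exact_mod_cast hn)
  have hsn : s * s = n := Real.mul_self_sqrt (by positivity)
  have hc : -1 / s < (1 : ℝ) / 2 := by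
    have : -1 / s ≤ 0 := div_nonpos_of_nonpos_of_nonneg (by norm_num) (by linarith)
    linarith
  have h1 : ∫ x, exp (-√(∑ i, x i ^ 2)) ∂(gm (Fin n)) ≤
      ∫ x : Fin n → ℝ, (exp (-1 / s * ∑ i, x i ^ 2) + exp (-s)) ∂(gm (Fin n)) := by
    refine integral_mono_of_nonneg (Filter.Eventually.of_forall fun x => (exp_pos _).le)
      ((integrable_exp_sum_sq hc).add (integrable_const _)) (Filter.Eventually.of_forall fun x => ?_)
    simp only
    have hS : 0 ≤ ∑ i, x i ^ 2 := by positivity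
    set t := √(∑ i, x i ^ 2)
    have ht : t ^ 2 = ∑ i, x i ^ 2 := Real.sq_sqrt hS
    have ht0 : 0 ≤ t := Real.sqrt_nonneg _
    rw [← ht]
    rcases le_total t s with h | h
    · have : exp (-t) ≤ exp (-1 / s * t ^ 2) := by
        apply Real.exp_le_exp.2
        have : -1 / s * t ^ 2 = -(t * (t / s)) := by ring
        rw [this]
        have : t / s ≤ 1 := (div_le_one (by linarith)).2 h
        nlinarith
      linarith [exp_pos (-s)]
    · have : exp (-t) ≤ exp (-s) := Real.exp_le_exp.2 (by linarith)
      linarith [exp_pos (-1 / s * t ^ 2)]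
  rw [integral_add (integrable_exp_sum_sq hc) (integrable_const _), integral_exp_sum_sq hc] at h1
  have h2 : 1 ≤ exp (2 * (-(1 / s) + 1 / s ^ 2)) * (1 - 2 * (-1 / s)) := by
    have hpos : 0 < 1 + 2 / s := by positivity
    have a2 : 1 - 2 * (-1 / s) = 1 + 2 / s := by ring
    rw [a2, ← Real.exp_log hpos, ← Real.exp_add]
    apply Real.one_le_exp
    have a3 := Real.le_log_one_add_of_nonneg (x := 2 / s) (by positivity)
    have a4 : 2 * (1 / s) - 2 * (1 / s ^ 2) ≤ 2 * (2 / s) / (2 / s + 2) := by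
      have : 2 * (2 / s) / (2 / s + 2) - (2 * (1 / s) - 2 * (1 / s ^ 2)) = 2 / (s ^ 2 * (s + 1)) := by
        field_simp; ring
      have : 0 ≤ 2 / (s ^ 2 * (s + 1)) := by positivity
      linarith
    linarith
  have h3 := inv_sqrt_pow_le n hc h2
  have h4 : (n : ℝ) * (-(1 / s) + 1 / s ^ 2) = 1 - s := by
    rw [← hsn]; field_simp; ring
  rw [h4] at h3
  have h5 : exp (-s) ≤ exp (1 - s) := Real.exp_le_exp.2 (by linarith)
  simp only [integral_const, probReal_univ, one_smul] at h1
  linarith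

/-- uncurried matrix -/
lemma mp_uncurry (p q : ℕ) : MeasurePreserving
    (fun (e : Fin p → Fin q → ℝ) (a : Fin p × Fin q) => e a.1 a.2)
    (gaussMatrix p q) (gm (Fin p × Fin q)) := by
  have hm : Measurable (fun (e : Fin p → Fin q → ℝ) (a : Fin p × Fin q) => e a.1 a.2) := by
    fun_prop
  refine ⟨hm, ?_⟩
  unfold gm
  symm
  refine Measure.pi_eq fun s hs => ?_
  rw [Measure.map_apply hm (MeasurableSet.univ_pi hs)]
  have : (fun (e : Fin p → Fin q → ℝ) (a : Fin p × Fin q) => e a.1 a.2) ⁻¹' (Set.univ.pi s)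
      = Set.univ.pi (fun i => Set.univ.pi (fun j => s (i, j))) := by
    ext e
    simp only [Set.mem_preimage, Set.mem_univ_pi, Prod.forall]
  rw [this, gaussMatrix, Measure.pi_pi, Fintype.prod_prod_type]
  simp_rw [Measure.pi_pi]

set_option linter.unusedSectionVars false

section
variable {V : Type} [Fintype V] [DecidableEq V] [Nonempty V] {p q : ℕ} {k r ε : ℝ}

/-- the soft-max functional of the Gaussian matrix -/
noncomputable def HH (k r ε : ℝ) (x : V → Fin q → ℝ) (e : Fin p → Fin q → ℝ) : ℝ :=
  exp (r * log (∑ v, exp (k * √(ε + ∑ i, (∑ j, x v j * e i j) ^ 2))))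

lemma HH_cont (x : V → Fin q → ℝ) : Continuous (HH (p := p) k r ε x) := by
  unfold HH
  refine Real.continuous_exp.comp (continuous_const.mul (Continuous.log (by fun_prop) fun e => ?_))
  exact (Finset.sum_pos (fun _ _ => exp_pos _) Finset.univ_nonempty).ne'

lemma lhs_eq (hr : r ≠ 0) (x : V → Fin q → ℝ) :
    ∫ y, FF k r ε (fun a : V × Option (Fin p) => ∑ i, AA x a i * y i)
        ∂(gm ((Fin p × Fin q) ⊕ Unit)) =
      (∫ e, HH k r ε x e ∂(gaussMatrix p q)) * exp ((r * k) ^ 2 / 2) := by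
  have mp := measurePreserving_sumPiEquivProdPi (ι := Fin p × Fin q) (ι' := Unit) (X := fun _ => ℝ)
    (fun _ => gaussianReal 0 1)
  have e1 : ∀ y : (Fin p × Fin q) ⊕ Unit → ℝ,
      FF k r ε (fun a : V × Option (Fin p) => ∑ i, AA x a i * y i) =
      HH k r ε x (fun i j => y (Sum.inl (i, j))) * exp (r * k * y (Sum.inr ())) := by
    intro y
    have hT : 0 < ∑ v, exp (k * √(ε + ∑ i, (∑ j, x v j * y (Sum.inl (i, j))) ^ 2)) :=
      Finset.sum_pos (fun _ _ => exp_pos _) Finset.univ_nonempty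
    have hl : LL k ε (fun a : V × Option (Fin p) => ∑ i, AA x a i * y i) =
        log (∑ v, exp (k * √(ε + ∑ i, (∑ j, x v j * y (Sum.inl (i, j))) ^ 2)))
          + k * y (Sum.inr ()) := by
      rw [← Real.log_exp (k * y (Sum.inr ())), ← Real.log_mul hT.ne' (exp_pos _).ne',
        Finset.sum_mul]
      unfold LL
      congr 1
      refine Finset.sum_congr rfl fun v _ => ?_
      rw [← Real.exp_add, ← mul_add]
      simp [ell, nn, AA, Fintype.sum_prod_type]
    unfold FF HH
    rw [hl, ← Real.exp_add]
    congr 1; ring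
  simp_rw [e1]
  have e2 := mp.integral_comp' (fun z : (Fin p × Fin q → ℝ) × (Unit → ℝ) =>
    HH k r ε x (fun i j => z.1 (i, j)) * exp (r * k * z.2 ()))
  have e3 := integral_prod_mul (μ := gm (Fin p × Fin q)) (ν := gm Unit)
    (fun w : Fin p × Fin q → ℝ => HH k r ε x (fun i j => w (i, j)))
    (fun w : Unit → ℝ => exp (r * k * w ()))
  refine e2.trans (e3.trans ?_)
  have hu := mp_uncurry p q
  have c1 : Continuous (fun w : Fin p × Fin q → ℝ => HH k r ε x (fun i j => w (i, j))) :=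
    (HH_cont x).comp (by fun_prop)
  rw [← hu.map_eq, integral_map hu.measurable.aemeasurable c1.aestronglyMeasurable]
  congr 1
  have hev : MeasurePreserving (Function.eval ()) (gm Unit) (gaussianReal 0 1) :=
    measurePreserving_eval (fun _ : Unit => gaussianReal 0 1) ()
  have hg := mgf_gaussianReal (p := gaussianReal 0 1) (X := id) (μ := 0) (v := 1) (by simp) (r * k)
  have c2 : Continuous (fun t : ℝ => exp (r * k * t)) := by fun_prop
  have e4 := integral_map (μ := gm Unit) hev.measurable.aemeasurable (f := fun t : ℝ => exp (r * k * t))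
    c2.aestronglyMeasurable
  rw [hev.map_eq] at e4
  refine e4.symm.trans ?_
  simpa [mgf] using hg

lemma sqrt_sum_le {n : ℕ} (ε : ℝ) (hε : 0 ≤ ε) (g : Fin n → ℝ) :
    √(ε + ∑ i, g i ^ 2) ≤ √ε + ∑ i, |g i| := by
  apply Real.sqrt_le_iff.2
  have h0 : 0 ≤ ∑ i, |g i| := by positivity
  refine ⟨by positivity, ?_⟩
  have h1 : ∑ i, g i ^ 2 ≤ (∑ i, |g i|) ^ 2 := by
    have := Finset.sum_sq_le_sq_sum_of_nonneg (s := Finset.univ) (f := fun i => |g i|)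
      (fun i _ => abs_nonneg _)
    simpa using this
  have h2 := Real.sq_sqrt hε
  nlinarith [Real.sqrt_nonneg ε, mul_nonneg (Real.sqrt_nonneg ε) h0]

lemma rhs_le (hε : 0 < ε) (hr : 0 < r) (x : V → Fin q → ℝ)
    (hx : ∀ v, ∑ j, x v j ^ 2 = 1) :
    ∫ y, FF k r ε (fun a : V × Option (Fin p) => ∑ i, BB x a i * y i) ∂(gm (Fin p ⊕ Fin q)) ≤
      exp (r * log (Fintype.card V)) * ((∫ g, exp (r * k * √(ε + ∑ i, g i ^ 2)) ∂(gm (Fin p))) *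
        ∫ h, exp (|r * k| * √(∑ j, h j ^ 2)) ∂(gm (Fin q))) := by
  have mp := measurePreserving_sumPiEquivProdPi (ι := Fin p) (ι' := Fin q) (X := fun _ => ℝ)
    (fun _ => gaussianReal 0 1)
  have e2 := mp.integral_comp' (fun z : (Fin p → ℝ) × (Fin q → ℝ) =>
    exp (r * k * √(ε + ∑ i, z.1 i ^ 2)) * exp (|r * k| * √(∑ j, z.2 j ^ 2)))
  have e3 := integral_prod_mul (μ := gm (Fin p)) (ν := gm (Fin q))
    (fun g : Fin p → ℝ => exp (r * k * √(ε + ∑ i, g i ^ 2)))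
    (fun h : Fin q → ℝ => exp (|r * k| * √(∑ j, h j ^ 2)))
  rw [← e3]
  refine le_trans ?_ (le_of_eq (congrArg _ e2))
  rw [← integral_const_mul]
  have hN : (0 : ℝ) < Fintype.card V := by exact_mod_cast Fintype.card_pos
  refine integral_mono_of_nonneg (Filter.Eventually.of_forall fun x => (exp_pos _).le) ?_
    (Filter.Eventually.of_forall fun y => ?_)
  · have hG : Gr (fun y : Fin p ⊕ Fin q → ℝ => exp (r * k * √(ε + ∑ i, y (Sum.inl i) ^ 2)) *
        exp (|r * k| * √(∑ j, y (Sum.inr j) ^ 2))) := by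
      refine ⟨by fun_prop, exp (|r * k| * √ε) + |r * k|, by positivity, fun y => ?_⟩
      beta_reduce
      rw [abs_of_pos (by positivity), ← Real.exp_add]
      have b1 := sqrt_sum_le ε hε.le (fun i => y (Sum.inl i))
      have b2 := sqrt_sum_le 0 le_rfl (fun i => y (Sum.inr i))
      simp only [zero_add, Real.sqrt_zero] at b2
      have b3 : ∑ i, |y i| = ∑ i, |y (Sum.inl i)| + ∑ i, |y (Sum.inr i)| :=
        Fintype.sum_sum_type _
      have b4 : r * k * √(ε + ∑ i, y (Sum.inl i) ^ 2) ≤ |r * k| * √(ε + ∑ i, y (Sum.inl i) ^ 2) := by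
        gcongr; exact le_abs_self _
      have b0 : 0 ≤ ∑ i, |y i| := by positivity
      calc _ ≤ exp (|r * k| * √ε + |r * k| * ∑ i, |y i|) := by
            apply Real.exp_le_exp.2
            rw [b3]
            nlinarith [abs_nonneg (r * k)]
        _ = exp (|r * k| * √ε) * exp (|r * k| * ∑ i, |y i|) := Real.exp_add _ _
        _ ≤ _ := by
            gcongr
            · linarith [abs_nonneg (r * k)]
            · linarith [exp_pos (|r * k| * √ε)]
    exact (hG.const_mul _).integrable
  · change FF k r ε (fun a : V × Option (Fin p) => ∑ i, BB x a i * y i) ≤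
      exp (r * log (Fintype.card V)) * (exp (r * k * √(ε + ∑ i, y (Sum.inl i) ^ 2)) *
        exp (|r * k| * √(∑ j, y (Sum.inr j) ^ 2)))
    unfold FF LL
    rw [← Real.exp_add, ← Real.exp_add]
    apply Real.exp_le_exp.2
    set n := √(ε + ∑ i, y (Sum.inl i) ^ 2) with hn
    set m := √(∑ j, y (Sum.inr j) ^ 2) with hm
    have h1 : ∑ v, exp (k * ell ε v (fun a : V × Option (Fin p) => ∑ i, BB x a i * y i)) ≤
        Fintype.card V * exp (k * n + |k| * m) := by
      rw [← nsmul_eq_mul]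
      refine Finset.sum_le_card_nsmul _ _ _ fun v _ => ?_
      apply Real.exp_le_exp.2
      have e : ell ε v (fun a : V × Option (Fin p) => ∑ i, BB x a i * y i) =
          n + ∑ j, x v j * y (Sum.inr j) := by
        simp [ell, nn, BB, hn]
      rw [e, mul_add]
      have cs : |∑ j, x v j * y (Sum.inr j)| ≤ m := by
        rw [hm]
        apply Real.abs_le_sqrt
        have := Finset.sum_mul_sq_le_sq_mul_sq Finset.univ (x v) (fun j => y (Sum.inr j))
        rwa [hx v, one_mul] at this
      have : k * ∑ j, x v j * y (Sum.inr j) ≤ |k| * m := by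
        refine (le_abs_self _).trans ?_
        rw [abs_mul]; gcongr
      linarith
    have h2 := Real.log_le_log (T_pos _) h1
    rw [Real.log_mul hN.ne' (exp_pos _).ne', Real.log_exp] at h2
    have h3 := mul_le_mul_of_nonneg_left h2 hr.le
    rw [abs_mul, abs_of_pos hr]
    linarith

lemma main_comparison (hε : 0 < ε) (hr : 0 < r) (hr1 : r ≤ 1) (x : V → Fin q → ℝ)
    (hx : ∀ v, ∑ j, x v j ^ 2 = 1) :
    (∫ e, HH k r ε x e ∂(gaussMatrix p q)) * exp ((r * k) ^ 2 / 2) ≤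
      exp (r * log (Fintype.card V)) * ((∫ g, exp (r * k * √(ε + ∑ i, g i ^ 2)) ∂(gm (Fin p))) *
        ∫ h, exp (|r * k| * √(∑ j, h j ^ 2)) ∂(gm (Fin q))) := by
  rw [← lhs_eq hr.ne' x]
  exact (comparison hε hr.le hr1 x hx).trans (rhs_le hε hr x hx)

end



lemma integrable_exp_norm (n : ℕ) (c : ℝ) :
    Integrable (fun x : Fin n → ℝ => exp (c * √(∑ i, x i ^ 2))) (gm (Fin n)) := by
  have hG : Gr (fun x : Fin n → ℝ => exp (c * √(∑ i, x i ^ 2))) := by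
    refine ⟨by fun_prop, 1 + |c|, by positivity, fun y => ?_⟩
    beta_reduce
    rw [abs_of_pos (exp_pos _)]
    have b2 := sqrt_sum_le 0 le_rfl y
    simp only [zero_add, Real.sqrt_zero] at b2
    have b0 : 0 ≤ ∑ i, |y i| := by positivity
    have b1 : c * √(∑ i, y i ^ 2) ≤ (1 + |c|) * ∑ i, |y i| := by
      have h1 : c * √(∑ i, y i ^ 2) ≤ |c| * √(∑ i, y i ^ 2) := by
        gcongr; exact le_abs_self _
      have h2 : |c| * √(∑ i, y i ^ 2) ≤ |c| * ∑ i, |y i| := by gcongr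
      linarith
    calc exp (c * √(∑ i, y i ^ 2)) ≤ exp ((1 + |c|) * ∑ i, |y i|) := Real.exp_le_exp.2 b1
      _ ≤ (1 + |c|) * exp ((1 + |c|) * ∑ i, |y i|) := by
          apply le_mul_of_one_le_left (exp_pos _).le
          linarith [abs_nonneg c]
  exact hG.integrable

set_option linter.unusedSectionVars false

section
variable {V : Type} [Fintype V] [DecidableEq V] [Nonempty V] {p q : ℕ} {k r ε : ℝ}

lemma HH_integrable (hε : 0 < ε) (hr : 0 < r) (x : V → Fin q → ℝ)
    (hx : ∀ v, ∑ j, x v j ^ 2 = 1) : Integrable (HH k r ε x) (gaussMatrix p q) := by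
  have hG : Gr (fun w : Fin p × Fin q → ℝ => HH k r ε x (fun i j => w (i, j))) := by
    refine ⟨(HH_cont x).comp (by fun_prop),
      exp (r * log (Fintype.card V) + r * |k| * √ε) + r * |k|, by positivity, fun w => ?_⟩
    beta_reduce
    unfold HH
    rw [abs_of_pos (exp_pos _)]
    have hN : (0 : ℝ) < Fintype.card V := by exact_mod_cast Fintype.card_pos
    have b0 : 0 ≤ ∑ a, |w a| := by positivity
    have h1 : ∑ v, exp (k * √(ε + ∑ i, (∑ j, x v j * w (i, j)) ^ 2)) ≤
        Fintype.card V * exp (|k| * (√ε + ∑ a, |w a|)) := by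
      rw [← nsmul_eq_mul]
      refine Finset.sum_le_card_nsmul _ _ _ fun v _ => ?_
      apply Real.exp_le_exp.2
      have hxj : ∀ j, |x v j| ≤ 1 := by
        intro j
        have : x v j ^ 2 ≤ ∑ j, x v j ^ 2 :=
          Finset.single_le_sum (f := fun j => x v j ^ 2) (fun _ _ => sq_nonneg _)
            (Finset.mem_univ j)
        rw [hx v] at this
        exact abs_le_one_iff_mul_self_le_one.2 (by nlinarith)
      have c1 := sqrt_sum_le ε hε.le (fun i => ∑ j, x v j * w (i, j))
      have c2 : ∑ i, |∑ j, x v j * w (i, j)| ≤ ∑ a, |w a| := by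
        rw [Fintype.sum_prod_type]
        refine Finset.sum_le_sum fun i _ => (Finset.abs_sum_le_sum_abs _ _).trans
          (Finset.sum_le_sum fun j _ => ?_)
        rw [abs_mul]
        exact mul_le_of_le_one_left (abs_nonneg _) (hxj j)
      calc k * √(ε + ∑ i, (∑ j, x v j * w (i, j)) ^ 2)
          ≤ |k| * √(ε + ∑ i, (∑ j, x v j * w (i, j)) ^ 2) := by
            gcongr; exact le_abs_self _
        _ ≤ _ := by gcongr; exact c1.trans (by linarith)
    have hT : 0 < ∑ v, exp (k * √(ε + ∑ i, (∑ j, x v j * w (i, j)) ^ 2)) :=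
      Finset.sum_pos (fun _ _ => exp_pos _) Finset.univ_nonempty
    have h2 := Real.log_le_log hT h1
    rw [Real.log_mul hN.ne' (exp_pos _).ne', Real.log_exp] at h2
    have h3 := mul_le_mul_of_nonneg_left h2 hr.le
    calc _ ≤ exp ((r * log (Fintype.card V) + r * |k| * √ε) + r * |k| * ∑ a, |w a|) := by
          apply Real.exp_le_exp.2; linarith
      _ = exp (r * log (Fintype.card V) + r * |k| * √ε) * exp (r * |k| * ∑ a, |w a|) :=
          Real.exp_add _ _
      _ ≤ _ := by
          have : 0 ≤ r * |k| := by positivity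
          gcongr
          · linarith
          · linarith [exp_pos (r * log (Fintype.card V) + r * |k| * √ε)]
  exact (mp_uncurry p q).integrable_comp_of_integrable hG.integrable

lemma le_HH (hr : 0 < r) (x : V → Fin q → ℝ) (e : Fin p → Fin q → ℝ) (v : V) :
    exp (r * k * √(ε + ∑ i, (∑ j, x v j * e i j) ^ 2)) ≤ HH k r ε x e := by
  unfold HH
  apply Real.exp_le_exp.2
  rw [mul_assoc]
  gcongr
  rw [Real.le_log_iff_exp_le (Finset.sum_pos (fun _ _ => exp_pos _) Finset.univ_nonempty)]
  exact Finset.single_le_sum (f := fun v => exp (k * √(ε + ∑ i, (∑ j, x v j * e i j) ^ 2)))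
    (fun _ _ => (exp_pos _).le) (Finset.mem_univ v)

lemma card_bound (hr : 0 < r) (hrN : r * Fintype.card V ≤ 1 / 4) :
    r * log (Fintype.card V) ≤ 1 / 4 := by
  have hN : (0 : ℝ) < Fintype.card V := by exact_mod_cast Fintype.card_pos
  have := Real.log_le_sub_one_of_pos hN
  nlinarith

lemma HH_plus (hq : 1 ≤ q) (hp : 1 ≤ p) (hr : 0 < r) (hr1 : r ≤ 1)
    (hrN : r * Fintype.card V ≤ 1 / 4) (x : V → Fin q → ℝ) (hx : ∀ v, ∑ j, x v j ^ 2 = 1) :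
    ∫ e, HH (1 / r) r (1 / 16) x e ∂(gaussMatrix p q) ≤ exp (√p + √q + 1) := by
  have h := main_comparison (p := p) (k := 1 / r) (ε := 1 / 16) (by norm_num) hr hr1 x hx
  have hk : r * (1 / r) = 1 := by field_simp
  simp only [hk, abs_one, one_mul] at h
  have h1 : ∫ g, exp (√(1 / 16 + ∑ i, g i ^ 2)) ∂(gm (Fin p)) ≤ exp (1 / 4) * exp (√p + 1 / 2) := by
    refine le_trans ?_ (mul_le_mul_of_nonneg_left (h_bound hp) (exp_pos _).le)
    rw [← integral_const_mul]
    have hi := integrable_exp_norm p 1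
    simp only [one_mul] at hi
    refine integral_mono_of_nonneg (Filter.Eventually.of_forall fun x => (exp_pos _).le)
      (hi.const_mul _) (Filter.Eventually.of_forall fun g => ?_)
    beta_reduce
    rw [← Real.exp_add]
    apply Real.exp_le_exp.2
    have hS : 0 ≤ ∑ i, g i ^ 2 := by positivity
    have := Real.sq_sqrt hS
    apply Real.sqrt_le_iff.2
    have h0 := Real.sqrt_nonneg (∑ i, g i ^ 2)
    constructor
    · linarith
    · nlinarith
  have h2 := h_bound hq
  have h3 : exp (r * log (Fintype.card V)) ≤ exp (1 / 4) := Real.exp_le_exp.2 (card_bound hr hrN)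
  have h4 : (∫ e, HH (1 / r) r (1 / 16) x e ∂(gaussMatrix p q)) * exp (1 ^ 2 / 2) ≤
      exp (1 / 4) * ((exp (1 / 4) * exp (√p + 1 / 2)) * exp (√q + 1 / 2)) := by
    refine h.trans ?_
    have n1 : 0 ≤ ∫ g, exp (√(1 / 16 + ∑ i, g i ^ 2)) ∂(gm (Fin p)) :=
      integral_nonneg fun _ => (exp_pos _).le
    have n2 : 0 ≤ ∫ x, exp (√(∑ i, x i ^ 2)) ∂(gm (Fin q)) :=
      integral_nonneg fun _ => (exp_pos _).le
    gcongr
  rw [← Real.exp_add, ← Real.exp_add, ← Real.exp_add] at h4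
  refine le_of_mul_le_mul_right (h4.trans (le_of_eq ?_)) (exp_pos (1 ^ 2 / 2))
  rw [← Real.exp_add]
  congr 1; ring

lemma HH_minus (hq : 1 ≤ q) (hp : 1 ≤ p) (hr : 0 < r) (hr1 : r ≤ 1)
    (hrN : r * Fintype.card V ≤ 1 / 4) (x : V → Fin q → ℝ) (hx : ∀ v, ∑ j, x v j ^ 2 = 1) :
    ∫ e, exp (1 / 4) * HH (-1 / r) r (1 / 16) x e ∂(gaussMatrix p q)
      ≤ 2 * exp (3 / 2 - √p + √q) := by
  have h := main_comparison (p := p) (k := -1 / r) (ε := 1 / 16) (by norm_num) hr hr1 x hx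
  have hk : r * (-1 / r) = -1 := by field_simp
  simp only [hk, abs_neg, abs_one, one_mul, neg_mul] at h
  have h1 : ∫ g, exp (-√(1 / 16 + ∑ i, g i ^ 2)) ∂(gm (Fin p)) ≤ 2 * exp (1 - √p) := by
    refine le_trans ?_ (g_bound hp)
    have hi := integrable_exp_norm p (-1)
    simp only [one_mul, neg_mul] at hi
    refine integral_mono_of_nonneg (Filter.Eventually.of_forall fun x => (exp_pos _).le)
      hi (Filter.Eventually.of_forall fun g => ?_)
    beta_reduce
    apply Real.exp_le_exp.2
    apply neg_le_neg
    apply Real.sqrt_le_sqrt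
    linarith
  have h2 := h_bound hq
  have h3 : exp (r * log (Fintype.card V)) ≤ exp (1 / 4) := Real.exp_le_exp.2 (card_bound hr hrN)
  have h4 : (∫ e, HH (-1 / r) r (1 / 16) x e ∂(gaussMatrix p q)) * exp ((-1) ^ 2 / 2) ≤
      exp (1 / 4) * ((2 * exp (1 - √p)) * exp (√q + 1 / 2)) := by
    refine h.trans ?_
    have n1 : 0 ≤ ∫ g, exp (-√(1 / 16 + ∑ i, g i ^ 2)) ∂(gm (Fin p)) :=
      integral_nonneg fun _ => (exp_pos _).le
    have n2 : 0 ≤ ∫ x, exp (√(∑ i, x i ^ 2)) ∂(gm (Fin q)) :=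
      integral_nonneg fun _ => (exp_pos _).le
    gcongr
  rw [integral_const_mul]
  have h5 : exp (1 / 4) * ((2 * exp (1 - √p)) * exp (√q + 1 / 2)) * exp (1 / 4)
      = 2 * exp (3 / 2 - √p + √q) * exp ((-1) ^ 2 / 2) := by
    have : exp (1 / 4) * ((2 * exp (1 - √p)) * exp (√q + 1 / 2)) * exp (1 / 4)
      = 2 * (exp (1 / 4) * exp (1 - √p) * exp (√q + 1 / 2) * exp (1 / 4)) := by ring
    rw [this, mul_assoc 2, ← Real.exp_add, ← Real.exp_add, ← Real.exp_add, ← Real.exp_add]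
    congr 2; ring
  have h6 := mul_le_mul_of_nonneg_right h4 (exp_pos (1 / 4)).le
  rw [h5] at h6
  refine le_of_mul_le_mul_right (le_trans (le_of_eq ?_) h6) (exp_pos ((-1) ^ 2 / 2))
  ring

end

lemma fatou {Ω : Type} [MeasurableSpace Ω] (μ : Measure Ω) (f : ℕ → Ω → ℝ)
    (hm : ∀ n, Measurable (f n)) (h0 : ∀ n x, 0 ≤ f n x) (hi : ∀ n, Integrable (f n) μ) (C : ℝ)
    (hC : ∀ n, ∫ x, f n x ∂μ ≤ C) :
    ∃ g : Ω → ENNReal, Measurable g ∧ ∫⁻ x, g x ∂μ ≤ ENNReal.ofReal C ∧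
      ∀ x c n0, (∀ n, n0 ≤ n → c ≤ f n x) → ENNReal.ofReal c ≤ g x := by
  refine ⟨fun x => Filter.liminf (fun n => ENNReal.ofReal (f n x)) Filter.atTop,
    Measurable.liminf fun n => (hm n).ennreal_ofReal, ?_, ?_⟩
  · refine (lintegral_liminf_le fun n => (hm n).ennreal_ofReal).trans ?_
    refine Filter.liminf_le_of_le (by isBoundedDefault) fun b hb => ?_
    obtain ⟨n, hn⟩ := hb.exists
    refine hn.trans ?_
    rw [← ofReal_integral_eq_lintegral_ofReal (hi n) (Filter.Eventually.of_forall (h0 n))]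
    exact ENNReal.ofReal_le_ofReal (hC n)
  · intro x c n0 h
    refine Filter.le_liminf_of_le (by isBoundedDefault) ?_
    filter_upwards [Filter.eventually_ge_atTop n0] with n hn
    exact ENNReal.ofReal_le_ofReal (h n hn)

lemma scalar_bound {P Q s Gp Gm : ℝ} (hQ : 0 ≤ Q) (hQP : Q ≤ P) (hs : 0 ≤ s)
    (h1 : exp s ≤ Gp) (h2 : exp (-s) ≤ Gm) :
    |s ^ 2 - P ^ 2| ≤ 3 * (P * Q) + (4 * P * exp (-(P + Q) - 1) + 4 * exp (-(P + Q) - 2)) * Gp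
      + 2 * P * exp (P - Q - 1) * Gm := by
  have hP : 0 ≤ P := hQ.trans hQP
  have hGp : 0 < Gp := (exp_pos _).trans_le h1
  have hGm : 0 < Gm := (exp_pos _).trans_le h2
  have t1 : 0 ≤ (4 * P * exp (-(P + Q) - 1) + 4 * exp (-(P + Q) - 2)) * Gp := by positivity
  have t2 : 0 ≤ 2 * P * exp (P - Q - 1) * Gm := by positivity
  have t0 : 0 ≤ P * Q := by positivity
  have a1 : (4 * P * exp (-(P + Q) - 1) + 4 * exp (-(P + Q) - 2)) * exp s ≤
      (4 * P * exp (-(P + Q) - 1) + 4 * exp (-(P + Q) - 2)) * Gp := by gcongr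
  have a2 : 2 * P * exp (P - Q - 1) * exp (-s) ≤ 2 * P * exp (P - Q - 1) * Gm := by gcongr
  have e1 : exp (-(P + Q) - 1) * exp s = exp ((s - (P + Q)) - 1) := by
    rw [← Real.exp_add]; congr 1; ring
  have e2 : exp (-(P + Q) - 2) * exp s = exp ((s - (P + Q)) / 2 - 1) ^ 2 := by
    rw [← Real.exp_add, ← Real.exp_nat_mul]; congr 1; push_cast; ring
  have e3 : exp (P - Q - 1) * exp (-s) = exp ((P - Q - s) - 1) := by
    rw [← Real.exp_add]; congr 1; ring
  rw [abs_le]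
  constructor
  · rcases le_total P s with h | h
    · nlinarith
    · have b := Real.add_one_le_exp ((P - Q - s) - 1)
      have c : P * (P - Q - s) ≤ P * exp ((P - Q - s) - 1) := by gcongr; linarith
      rw [mul_assoc, e3] at a2
      nlinarith
  · rcases le_total s (P + Q) with h | h
    · nlinarith
    · have b := Real.add_one_le_exp ((s - (P + Q)) - 1)
      have b' := Real.add_one_le_exp ((s - (P + Q)) / 2 - 1)
      have c : P * (s - (P + Q)) ≤ P * exp ((s - (P + Q)) - 1) := by gcongr; linarith
      have d : ((s - (P + Q)) / 2) ^ 2 ≤ exp ((s - (P + Q)) / 2 - 1) ^ 2 := by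
        gcongr
        linarith
      have e4 : (4 * P * exp (-(P + Q) - 1) + 4 * exp (-(P + Q) - 2)) * exp s =
          4 * (P * exp ((s - (P + Q)) - 1)) + 4 * exp ((s - (P + Q)) / 2 - 1) ^ 2 := by
        rw [← e1, ← e2]; ring
      rw [e4] at a1
      have f1 : s ^ 2 - P ^ 2 = (Q ^ 2 + 2 * P * Q) + 2 * (P + Q) * (s - (P + Q))
        + (s - (P + Q)) ^ 2 := by ring
      have f2 : 2 * (P + Q) * (s - (P + Q)) ≤ 4 * (P * (s - (P + Q))) := by nlinarith
      nlinarith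

lemma opNorm_le {p q : ℕ} (e : Fin p → Fin q → ℝ) (C : ℝ)
    (h : ∀ v : EuclideanSpace ℝ (Fin q), ‖v‖ = 1 → |∑ i, (∑ j, v j * e i j) ^ 2 - p| ≤ C)
    (hC : 0 ≤ C) :
    opNorm ((Matrix.of e)ᵀ * Matrix.of e - (p : ℝ) • (1 : Matrix (Fin q) (Fin q) ℝ)) ≤ C := by
  unfold opNorm
  set A := (Matrix.of e)ᵀ * Matrix.of e - (p : ℝ) • (1 : Matrix (Fin q) (Fin q) ℝ) with hA
  have hH : A.IsHermitian := by
    rw [hA]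
    refine Matrix.IsHermitian.sub ?_ ?_
    · ext i j; simp [Matrix.mul_apply, mul_comm]
    · ext i j; simp [Matrix.one_apply, eq_comm]
  have hS := Matrix.isSymmetric_toEuclideanLin_iff.2 hH
  set T := LinearMap.toContinuousLinearMap (Matrix.toEuclideanLin A) with hT
  have hTs : T.IsSymmetric := hS
  rw [T.norm_eq_iSup_rayleighQuotient hTs]
  have key : ∀ v : EuclideanSpace ℝ (Fin q),
      inner ℝ (T v) v = ∑ i, (∑ j, v j * e i j) ^ 2 - p * ‖v‖ ^ 2 := by
    intro v
    have : inner ℝ (T v) v = v.ofLp ⬝ᵥ (A *ᵥ v.ofLp) := by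
      simp [hT, EuclideanSpace.inner_eq_star_dotProduct, Matrix.toEuclideanLin_apply]
    rw [this, hA, Matrix.sub_mulVec, dotProduct_sub, Matrix.smul_mulVec, Matrix.one_mulVec,
      dotProduct_smul, EuclideanSpace.real_norm_sq_eq, ← Matrix.mulVec_mulVec,
      Matrix.dotProduct_mulVec, Matrix.vecMul_transpose]
    simp [dotProduct, Matrix.mulVec, pow_two, mul_comm]
  refine Real.iSup_le (fun v => ?_) hC
  by_cases hv : v = 0
  · simp [hv, ContinuousLinearMap.rayleighQuotient, ContinuousLinearMap.reApplyInnerSelf, hC]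
  have hv0 : 0 < ‖v‖ := norm_pos_iff.2 hv
  have h1 := h (‖v‖⁻¹ • v) (by rw [norm_smul, norm_inv, norm_norm]; field_simp)
  have h2 : T.rayleighQuotient v = ∑ i, (∑ j, (‖v‖⁻¹ • v) j * e i j) ^ 2 - p := by
    rw [ContinuousLinearMap.rayleighQuotient, ContinuousLinearMap.reApplyInnerSelf_apply, RCLike.re_to_real, key v]
    have : ∀ i, (∑ j, (‖v‖⁻¹ • v) j * e i j) ^ 2 = (‖v‖ ^ 2)⁻¹ * (∑ j, v j * e i j) ^ 2 := by
      intro i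
      rw [← inv_pow, ← mul_pow, Finset.mul_sum]
      simp [mul_assoc]
    simp_rw [this]
    rw [← Finset.mul_sum]
    field_simp
  rw [h2]; exact h1


lemma main_pos {p q : ℕ} (hq : 1 ≤ q) (hpq : q ≤ p) :
    ∫ e, opNorm ((Matrix.of e)ᵀ * Matrix.of e
          - (p : ℝ) • (1 : Matrix (Fin q) (Fin q) ℝ)) ∂(gaussMatrix p q)
      ≤ 3 * (√p * √q) + 13 * √p := by
  have hp : 1 ≤ p := hq.trans hpq
  have hpr : (1 : ℝ) ≤ √p := Real.one_le_sqrt.2 (by exact_mod_cast hp)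
  haveI : Nonempty (Fin q) := ⟨⟨0, hq⟩⟩
  haveI : Nonempty (Metric.sphere (0 : EuclideanSpace ℝ (Fin q)) 1) := by
    refine ⟨⟨EuclideanSpace.single ⟨0, hq⟩ 1, by simp⟩⟩
  set d := TopologicalSpace.denseSeq (Metric.sphere (0 : EuclideanSpace ℝ (Fin q)) 1) with hd
  have hdd : DenseRange d := TopologicalSpace.denseRange_denseSeq _
  set R : ℕ → ℝ := fun N => 1 / (4 * ((N : ℝ) + 1)) with hR
  have hR0 : ∀ N, 0 < R N := fun N => by rw [hR]; positivity
  have hRc : ∀ N, R N * Fintype.card (Fin (N + 1)) ≤ 1 / 4 := fun N => by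
    rw [hR]; simp only [Fintype.card_fin]; push_cast; apply le_of_eq; field_simp
  have hR1 : ∀ N, R N ≤ 1 := fun N => by
    have := hRc N
    simp only [Fintype.card_fin] at this; push_cast at this
    have h1 := hR0 N
    have h2 : (0 : ℝ) ≤ N := by positivity
    nlinarith
  set x : ∀ N, Fin (N + 1) → Fin q → ℝ := fun N v j => (d v).1 j with hx
  have hx1 : ∀ N v, ∑ j, x N v j ^ 2 = 1 := by
    intro N v
    have h1 : ‖(d v).1‖ = 1 := by simpa using (d v).2
    have h2 := EuclideanSpace.real_norm_sq_eq (d v).1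
    rw [h1] at h2
    simp only [hx]; linarith
  obtain ⟨gp, hgpm, hgpi, hgp⟩ := fatou (gaussMatrix p q)
    (fun N => HH (1 / R N) (R N) (1 / 16) (x N)) (fun N => (HH_cont _).measurable)
    (fun N e => (exp_pos _).le) (fun N => HH_integrable (by norm_num) (hR0 N) _ (hx1 N)) _
    (fun N => HH_plus hq hp (hR0 N) (hR1 N) (hRc N) _ (hx1 N))
  obtain ⟨gn, hgnm, hgni, hgn⟩ := fatou (gaussMatrix p q)
    (fun N e => exp (1 / 4) * HH (-1 / R N) (R N) (1 / 16) (x N) e)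
    (fun N => ((HH_cont _).const_mul _).measurable)
    (fun N e => by unfold HH; positivity)
    (fun N => (HH_integrable (by norm_num) (hR0 N) _ (hx1 N)).const_mul _) _
    (fun N => HH_minus hq hp (hR0 N) (hR1 N) (hRc N) _ (hx1 N))
  set S : (Fin p → Fin q → ℝ) → EuclideanSpace ℝ (Fin q) → ℝ :=
    fun e v => √(∑ i, (∑ j, v j * e i j) ^ 2) with hS
  have kp : ∀ e n, ENNReal.ofReal (exp (S e (d n).1)) ≤ gp e := by
    intro e n
    refine hgp e _ n fun N hN => ?_
    refine le_trans ?_ (le_HH (hR0 N) (x N) e ⟨n, by omega⟩)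
    rw [mul_one_div_cancel (hR0 N).ne', one_mul]
    apply Real.exp_le_exp.2
    simp only [hS, hx]
    apply Real.sqrt_le_sqrt
    linarith
  have kn : ∀ e n, ENNReal.ofReal (exp (-S e (d n).1)) ≤ gn e := by
    intro e n
    refine hgn e _ n fun N hN => ?_
    refine le_trans ?_ (mul_le_mul_of_nonneg_left
      (le_HH (hR0 N) (x N) e ⟨n, by omega⟩) (exp_pos _).le)
    have hk : R N * (-1 / R N) = -1 := by have := (hR0 N).ne'; field_simp
    rw [hk, ← Real.exp_add]
    apply Real.exp_le_exp.2
    simp only [hS, hx]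
    have h0 : 0 ≤ ∑ i, (∑ j, (d n).1 j * e i j) ^ 2 := by positivity
    have h1 := Real.sq_sqrt h0
    have h2 := Real.sqrt_nonneg (∑ i, (∑ j, (d n).1 j * e i j) ^ 2)
    have : √(1 / 16 + ∑ i, (∑ j, (d n).1 j * e i j) ^ 2) ≤
        1 / 4 + √(∑ i, (∑ j, (d n).1 j * e i j) ^ 2) := by
      apply Real.sqrt_le_iff.2
      constructor
      · linarith
      · nlinarith
    linarith
  set a : ℝ := 4 * √p * exp (-(√p + √q) - 1) + 4 * exp (-(√p + √q) - 2) with ha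
  set b : ℝ := 2 * √p * exp (√p - √q - 1) with hb
  have ha0 : 0 < a := by positivity
  have hb0 : 0 < b := by positivity
  have hQP : √(q : ℝ) ≤ √p := Real.sqrt_le_sqrt (by exact_mod_cast hpq)
  have pw : ∀ e : Fin p → Fin q → ℝ, ENNReal.ofReal (opNorm ((Matrix.of e)ᵀ * Matrix.of e
      - (p : ℝ) • (1 : Matrix (Fin q) (Fin q) ℝ))) ≤
      ENNReal.ofReal (3 * (√p * √q)) + ENNReal.ofReal a * gp e + ENNReal.ofReal b * gn e := by
    intro e
    by_cases h1 : gp e = ⊤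
    · rw [h1, ENNReal.mul_top (by simpa using ha0)]; simp
    by_cases h2 : gn e = ⊤
    · rw [h2, ENNReal.mul_top (by simpa using hb0)]; simp
    obtain ⟨Gp, hGp⟩ : ∃ G, G = (gp e).toReal := ⟨_, rfl⟩
    obtain ⟨Gn, hGn⟩ : ∃ G, G = (gn e).toReal := ⟨_, rfl⟩
    have hGp0 : 0 ≤ Gp := by rw [hGp]; exact ENNReal.toReal_nonneg
    have hGn0 : 0 ≤ Gn := by rw [hGn]; exact ENNReal.toReal_nonneg
    have e1 : gp e = ENNReal.ofReal Gp := by rw [hGp, ENNReal.ofReal_toReal h1]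
    have e2 : gn e = ENNReal.ofReal Gn := by rw [hGn, ENNReal.ofReal_toReal h2]
    rw [e1, e2, ← ENNReal.ofReal_mul ha0.le, ← ENNReal.ofReal_mul hb0.le,
      ← ENNReal.ofReal_add (by positivity) (by positivity),
      ← ENNReal.ofReal_add (by positivity) (by positivity)]
    apply ENNReal.ofReal_le_ofReal
    refine opNorm_le e _ (fun v hv => ?_) (by positivity)
    have hSc : Continuous (fun w : Metric.sphere (0 : EuclideanSpace ℝ (Fin q)) 1 => S e w.1) := by
      simp only [hS]; fun_prop
    have f1 : ∀ w : Metric.sphere (0 : EuclideanSpace ℝ (Fin q)) 1, exp (S e w.1) ≤ Gp := by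
      intro w
      refine hdd.induction_on (p := fun w => exp (S e w.1) ≤ Gp) w
        (isClosed_le (Real.continuous_exp.comp hSc) continuous_const) fun n => ?_
      have := kp e n
      rw [e1] at this
      exact (ENNReal.ofReal_le_ofReal_iff hGp0).1 this
    have f2 : ∀ w : Metric.sphere (0 : EuclideanSpace ℝ (Fin q)) 1, exp (-S e w.1) ≤ Gn := by
      intro w
      refine hdd.induction_on (p := fun w => exp (-S e w.1) ≤ Gn) w
        (isClosed_le (Real.continuous_exp.comp hSc.neg) continuous_const) fun n => ?_
      have := kn e n
      rw [e2] at this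
      exact (ENNReal.ofReal_le_ofReal_iff hGn0).1 this
    have g1 := f1 ⟨v, by simpa using hv⟩
    have g2 := f2 ⟨v, by simpa using hv⟩
    have := scalar_bound (P := √p) (Q := √q) (s := S e v) (Real.sqrt_nonneg _) hQP
      (Real.sqrt_nonneg _) g1 g2
    simp only [hS] at this
    rw [Real.sq_sqrt (by positivity), Real.sq_sqrt (by positivity)] at this
    exact this
  have n0 : ∀ e : Fin p → Fin q → ℝ, 0 ≤ opNorm ((Matrix.of e)ᵀ * Matrix.of e
      - (p : ℝ) • (1 : Matrix (Fin q) (Fin q) ℝ)) := fun e => norm_nonneg _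
  by_cases hIntg : Integrable (fun e : Fin p → Fin q → ℝ => opNorm ((Matrix.of e)ᵀ * Matrix.of e
      - (p : ℝ) • (1 : Matrix (Fin q) (Fin q) ℝ))) (gaussMatrix p q)
  swap
  · rw [integral_undef hIntg]; positivity
  have hprob : IsProbabilityMeasure (gaussMatrix p q) := by unfold gaussMatrix; infer_instance
  rw [← ENNReal.ofReal_le_ofReal_iff (by positivity),
    ofReal_integral_eq_lintegral_ofReal hIntg (Filter.Eventually.of_forall n0)]
  refine (lintegral_mono pw).trans ?_
  rw [lintegral_add_right _ (hgnm.const_mul _), lintegral_add_right _ (hgpm.const_mul _),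
    lintegral_const, measure_univ, mul_one, lintegral_const_mul _ hgpm, lintegral_const_mul _ hgnm]
  calc _ ≤ ENNReal.ofReal (3 * (√p * √q)) + ENNReal.ofReal a * ENNReal.ofReal (exp (√p + √q + 1))
        + ENNReal.ofReal b * ENNReal.ofReal (2 * exp (3 / 2 - √p + √q)) := by gcongr
    _ = ENNReal.ofReal (3 * (√p * √q) + a * exp (√p + √q + 1)
        + b * (2 * exp (3 / 2 - √p + √q))) := by
      rw [← ENNReal.ofReal_mul ha0.le, ← ENNReal.ofReal_mul hb0.le,
        ← ENNReal.ofReal_add (by positivity) (by positivity),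
        ← ENNReal.ofReal_add (by positivity) (by positivity)]
    _ ≤ _ := by
      apply ENNReal.ofReal_le_ofReal
      have q1 : a * exp (√p + √q + 1) = 4 * √p + 4 * exp (-1) := by
        rw [ha, add_mul, mul_assoc, mul_assoc 4 (exp _), ← Real.exp_add, ← Real.exp_add]
        have : -(√(p : ℝ) + √q) - 1 + (√p + √q + 1) = 0 := by ring
        rw [this, Real.exp_zero, mul_one]
        congr 3; ring
      have q2 : b * (2 * exp (3 / 2 - √p + √q)) = 4 * √p * exp (1 / 2) := by
        rw [hb]
        have : 2 * √(p : ℝ) * exp (√p - √q - 1) * (2 * exp (3 / 2 - √p + √q))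
          = 4 * √p * (exp (√p - √q - 1) * exp (3 / 2 - √p + √q)) := by ring
        rw [this, ← Real.exp_add]
        congr 2; ring
      rw [q1, q2]
      have r1 : exp (-1) ≤ 1 / 2 := by
        rw [Real.exp_neg, one_div]
        exact inv_anti₀ (by norm_num) (by linarith [Real.exp_one_gt_d9])
      have r2 : exp (1 / 2) ≤ 1.7 := by
        have h : exp (1 / 2) ^ 2 = exp 1 := by rw [← Real.exp_nat_mul]; norm_num
        have := Real.exp_one_lt_d9
        nlinarith [exp_pos (1 / 2)]
      have r3 : √(p : ℝ) * exp (1 / 2) ≤ √p * 1.7 := by gcongr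
      linarith


end WishartAux

/-- For a `p×q` Gaussian matrix `E` with `p ≥ q`,
`E[‖EᵀE − p I_q‖_∞] ≤ 3√(pq) + 8 e^{−p/4} + √(64 π p)`. -/
theorem expected_opNorm_wishart_centered (p q : ℕ) (hpq : q ≤ p) :
    ∫ e, opNorm ((Matrix.of e)ᵀ * Matrix.of e
          - (p : ℝ) • (1 : Matrix (Fin q) (Fin q) ℝ)) ∂(gaussMatrix p q)
      ≤ 3 * Real.sqrt ((p : ℝ) * q) + 8 * Real.exp (-(p : ℝ) / 4)
        + Real.sqrt (64 * Real.pi * p) := by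
  rcases Nat.eq_zero_or_pos q with h | h
  · subst h
    have h0 : ∀ e : Fin p → Fin 0 → ℝ, opNorm ((Matrix.of e)ᵀ * Matrix.of e
          - (p : ℝ) • (1 : Matrix (Fin 0) (Fin 0) ℝ)) = 0 := by
      intro e
      unfold opNorm
      rw [Subsingleton.elim ((Matrix.of e)ᵀ * Matrix.of e
          - (p : ℝ) • (1 : Matrix (Fin 0) (Fin 0) ℝ)) 0]
      simp
    simp_rw [h0]
    rw [integral_zero]
    positivity
  · refine (WishartAux.main_pos h hpq).trans ?_
    rw [Real.sqrt_mul (by positivity : (0 : ℝ) ≤ (p : ℝ)) (q : ℝ),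
      Real.sqrt_mul (by positivity : (0 : ℝ) ≤ 64 * Real.pi) (p : ℝ)]
    have h1 : (13 : ℝ) ≤ √(64 * Real.pi) := by
      apply Real.le_sqrt_of_sq_le
      nlinarith [Real.pi_gt_three]
    have h2 := mul_le_mul_of_nonneg_right h1 (Real.sqrt_nonneg (p : ℝ))
    have h3 := Real.exp_pos (-(p : ℝ) / 4)
    linarith
end
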